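/- arXiv:math/0106089 — 2 statements merged into one kernel-verified Lean document; each statement's English description precedes it below -/
import Mathlib

section
/- Let q = 2^m with m odd. For λ ∈ F_q∖{0} and A ∈ F_q define f₃(x) = λx + λx⁻¹ + A + 1 for x ∈ F_q∖{0}, and M(f₃) = (1/2)·#{x ∈ F_q∖{0,1} : Tr(f₃(x)) = 0}. Then: (a) for every integer M₀ with (q − 3 − ⌊2√q⌋)/4 ≤ M₀ ≤ (q − 3 + ⌊2√q⌋)/4 there exist λ ∈ F_q∖{0} and A ∈ F_q with Tr(A+1) = 0 such that M(f₃) = M₀; and (b) for every integer M₀ with (q − 1 − ⌊2√q⌋)/4 ≤ M₀ ≤ (q − 1 + ⌊2√q⌋)/4 there exist λ ∈ F_q∖{0} and A ∈ F_q with Tr(A+1) = 1 such that M(f₃) = M₀. -/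
namespace PeriodPair

open Filter Topology

variable (L : PeriodPair)

/-- **Liouville's theorem** for elliptic functions: an elliptic function without poles is constant
off a discrete set. -/
lemma exists_eventually_eq_const {f : ℂ → ℂ} (hf : Meromorphic f)
    (hper : ∀ z, ∀ l ∈ L.lattice, f (z + l) = f z)
    (hord : ∀ x, 0 ≤ meromorphicOrderAt f x) :
    ∃ c, ∀ x, ∀ᶠ z in 𝓝[≠] x, f z = c := by
  have hf' : MeromorphicOn f Set.univ := fun x _ ↦ hf x
  set g := toMeromorphicNFOn f Set.univ with hg
  have hgf : ∀ x, ∀ᶠ z in 𝓝[≠] x, f z = g z := fun x ↦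
    (hf'.toMeromorphicNFOn_eq_self_on_nhdsNE (Set.mem_univ x)).symm
  have hga : ∀ x, AnalyticAt ℂ g x := fun x ↦ by
    rw [← (meromorphicNFOn_toMeromorphicNFOn f Set.univ
      (Set.mem_univ x)).meromorphicOrderAt_nonneg_iff_analyticAt,
      meromorphicOrderAt_toMeromorphicNFOn hf' (Set.mem_univ x)]
    exact hord x
  have hgd : Differentiable ℂ g := fun x ↦ (hga x).differentiableAt
  have hgper : ∀ z, ∀ l ∈ L.lattice, g (z + l) = g z := by
    intro z l hl
    have h1 : Tendsto (fun w ↦ g (w + l)) (𝓝[≠] z) (𝓝 (g (z + l))) :=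
      ((hgd.continuous.comp (continuous_id.add continuous_const)).tendsto z).mono_left
        nhdsWithin_le_nhds
    have h2 : Tendsto g (𝓝[≠] z) (𝓝 (g z)) :=
      (hgd.continuous.tendsto z).mono_left nhdsWithin_le_nhds
    refine tendsto_nhds_unique (h1.congr' ?_) h2
    have h3 : Tendsto (fun w ↦ w + l) (𝓝[≠] z) (𝓝[≠] (z + l)) := by
      refine tendsto_nhdsWithin_iff.mpr ⟨?_, ?_⟩
      · exact ((continuous_id.add continuous_const).tendsto z).mono_left nhdsWithin_le_nhds
      · filter_upwards [self_mem_nhdsWithin] with w hw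
        simpa using hw
    filter_upwards [h3.eventually (hgf (z + l)), hgf z] with w h4 h5
    rw [← h4, ← h5, hper w l hl]
  refine ⟨g 0, fun x ↦ ?_⟩
  filter_upwards [hgf x] with z hz
  rw [hz]
  exact hgd.apply_eq_apply_of_bounded
    (IsZLattice.isCompact_range_of_periodic L.lattice _ hgd.continuous hgper).isBounded z 0

lemma meromorphic_weierstrassP_sub_const (c : ℂ) : Meromorphic fun z ↦ L.weierstrassP z - c :=
  fun x ↦ (L.meromorphic_weierstrassP x).sub (MeromorphicAt.const c x)

lemma analyticAt_weierstrassP_sub_const (c : ℂ) {x : ℂ} (hx : x ∉ L.lattice) :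
    AnalyticAt ℂ (fun z ↦ L.weierstrassP z - c) x :=
  (L.analyticOnNhd_weierstrassP x hx).sub analyticAt_const

lemma order_weierstrassP_sub_const (c : ℂ) {x : ℂ} (hx : x ∈ L.lattice) :
    meromorphicOrderAt (fun z ↦ L.weierstrassP z - c) x = -2 := by
  have h := L.order_weierstrassP x hx
  have h2 : meromorphicOrderAt (L.weierstrassP + fun _ ↦ -c) x
      = meromorphicOrderAt L.weierstrassP x := by
    refine meromorphicOrderAt_add_eq_left_of_lt (MeromorphicAt.const _ x) ?_
    rw [h]
    refine lt_of_lt_of_le ?_ (analyticAt_const (v := -c)).meromorphicOrderAt_nonneg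
    exact WithTop.coe_lt_coe.mpr (by norm_num : (-2 : ℤ) < 0)
  rw [← h, ← h2]
  rfl

lemma order_weierstrassP_sub_const_nonneg (c : ℂ) {x : ℂ} (hx : x ∉ L.lattice) :
    0 ≤ meromorphicOrderAt (fun z ↦ L.weierstrassP z - c) x :=
  (L.analyticAt_weierstrassP_sub_const c hx).meromorphicOrderAt_nonneg

lemma one_le_order_weierstrassP_sub_const {c x : ℂ} (hx : x ∉ L.lattice)
    (h : L.weierstrassP x = c) :
    1 ≤ meromorphicOrderAt (fun z ↦ L.weierstrassP z - c) x := by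
  have ha := L.analyticAt_weierstrassP_sub_const c hx
  rw [ha.meromorphicOrderAt_eq]
  refine ENat.monotone_map_iff.mpr Nat.mono_cast
    ((natCast_le_analyticOrderAt_iff_iteratedDeriv_eq_zero (n := 1) ha).mpr fun i hi ↦ ?_)
  obtain rfl : i = 0 := by omega
  simp [h]

lemma derivWeierstrassP_eq_zero {x : ℂ} (h2 : 2 * x ∈ L.lattice) : L.derivWeierstrassP x = 0 := by
  have h := L.derivWeierstrassP_add_coe (-x) ⟨_, h2⟩
  rw [show -x + 2 * x = x by ring, L.derivWeierstrassP_neg] at h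
  exact CharZero.eq_neg_self_iff.mp h

lemma two_le_order_weierstrassP_sub_const {c x : ℂ} (hx : x ∉ L.lattice)
    (h2 : 2 * x ∈ L.lattice) (h : L.weierstrassP x = c) :
    2 ≤ meromorphicOrderAt (fun z ↦ L.weierstrassP z - c) x := by
  have ha := L.analyticAt_weierstrassP_sub_const c hx
  rw [ha.meromorphicOrderAt_eq]
  refine ENat.monotone_map_iff.mpr Nat.mono_cast
    ((natCast_le_analyticOrderAt_iff_iteratedDeriv_eq_zero (n := 2) ha).mpr fun i hi ↦ ?_)
  obtain rfl | rfl : i = 0 ∨ i = 1 := by omega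
  · simp [h]
  · rw [iteratedDeriv_one, deriv_sub_const, L.deriv_weierstrassP, L.derivWeierstrassP_eq_zero h2]

lemma order_weierstrassP_sub_const_ne_top (c x : ℂ) :
    meromorphicOrderAt (fun z ↦ L.weierstrassP z - c) x ≠ ⊤ := by
  refine MeromorphicOn.meromorphicOrderAt_ne_top_of_isPreconnected (x := 0) (U := Set.univ)
    (fun x _ ↦ L.meromorphic_weierstrassP_sub_const c x) isPreconnected_univ
    (Set.mem_univ _) (Set.mem_univ _) ?_
  rw [L.order_weierstrassP_sub_const c L.lattice.zero_mem]
  exact WithTop.coe_ne_top (a := (-2 : ℤ))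

/-- The product of the translates of `℘ - c` by the multiples of an `N`-division point `p` is a
nonzero constant as soon as it has no pole at the origin, and then has order zero there. -/
lemma prod_translates {N : ℕ} {p : ℂ} (hp : ∀ j : ℤ, (j : ℂ) * p ∈ L.lattice ↔ (N : ℤ) ∣ j)
    (c : ℂ) (h0 : 0 ≤ ∑ j ∈ Finset.range N,
      meromorphicOrderAt (fun z ↦ L.weierstrassP z - c) ((j : ℂ) * p)) :
    (∃ d ≠ 0, ∀ x, ∀ᶠ z in 𝓝[≠] x, ∏ j ∈ Finset.range N, (L.weierstrassP (z + j * p) - c) = d) ∧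
    ∑ j ∈ Finset.range N, meromorphicOrderAt (fun z ↦ L.weierstrassP z - c) ((j : ℂ) * p) = 0 := by
  set F : ℂ → ℂ := fun z ↦ ∏ j ∈ Finset.range N, (L.weierstrassP (z + j * p) - c) with hF
  have hmer : ∀ j ∈ Finset.range N, ∀ x,
      MeromorphicAt (fun z ↦ L.weierstrassP (z + j * p) - c) x := fun j _ x ↦
    (L.meromorphic_weierstrassP_sub_const c (x + j * p)).comp_analyticAt
      (f := fun z ↦ L.weierstrassP z - c) (g := fun z ↦ z + j * p) (by fun_prop)
  have hord : ∀ x, meromorphicOrderAt F x = ∑ j ∈ Finset.range N,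
      meromorphicOrderAt (fun z ↦ L.weierstrassP z - c) (x + j * p) := by
    intro x
    rw [hF, meromorphicOrderAt_fun_prod (fun j hj ↦ hmer j hj x)]
    refine Finset.sum_congr rfl fun j _ ↦ ?_
    exact meromorphicOrderAt_comp_add_const_eq_meromorphicOrderAt
      (f := fun z ↦ L.weierstrassP z - c)
  have hFmer : Meromorphic F := fun x ↦ MeromorphicAt.fun_prod (fun j hj ↦ hmer j hj x)
  have hper : ∀ z, ∀ l ∈ L.lattice, F (z + l) = F z := by
    intro z l hl
    refine Finset.prod_congr rfl fun j _ ↦ ?_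
    rw [add_right_comm, L.weierstrassP_add_coe _ ⟨l, hl⟩]
  have hshift1 : ∀ z, F (z + p) = F z := by
    intro z
    have h1 : (L.weierstrassP (z + (N : ℂ) * p) - c) =
        (L.weierstrassP (z + ((0 : ℕ) : ℂ) * p) - c) := by
      have hN : (N : ℂ) * p ∈ L.lattice := by simpa using (hp N).mpr dvd_rfl
      rw [L.weierstrassP_add_coe _ ⟨_, hN⟩]
      simp
    have h2 := Finset.prod_range_succ (fun j : ℕ ↦ L.weierstrassP (z + j * p) - c) N
    have h3 := Finset.prod_range_succ' (fun j : ℕ ↦ L.weierstrassP (z + j * p) - c) N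
    have h4 : F (z + p) =
        ∏ j ∈ Finset.range N, (L.weierstrassP (z + ((j + 1 : ℕ) : ℂ) * p) - c) := by
      refine Finset.prod_congr rfl fun j _ ↦ ?_
      congr 2
      push_cast; ring
    by_cases h5 : L.weierstrassP (z + ((0 : ℕ) : ℂ) * p) - c = 0
    · by_cases hN0 : N = 0
      · subst hN0; simp [hF]
      · obtain ⟨n, rfl⟩ := Nat.exists_eq_succ_of_ne_zero hN0
        rw [h4, Finset.prod_range_succ, Nat.succ_eq_add_one] at *
        rw [h1, h5, mul_zero, hF]
        exact (Finset.prod_eq_zero (Finset.mem_range.mpr (Nat.succ_pos n)) h5).symm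
    · rw [h4]
      refine mul_right_cancel₀ h5 ?_
      rw [← h3, h2, h1]
  have hshift : ∀ (k : ℤ) z, F (z + k * p) = F z := by
    intro k
    induction k using Int.induction_on with
    | zero => simp
    | succ k ih =>
      intro z
      rw [← ih z, ← hshift1 (z + ((k : ℤ) : ℂ) * p)]
      congr 1; push_cast; ring
    | pred k ih =>
      intro z
      rw [← ih z, ← hshift1 (z + ((-(k : ℤ) - 1 : ℤ) : ℂ) * p)]
      congr 1; push_cast; ring
  have hFord0 : 0 ≤ meromorphicOrderAt F 0 := by rw [hord]; simpa using h0
  have hnonneg : ∀ x, 0 ≤ meromorphicOrderAt F x := by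
    intro x
    by_cases hx : ∃ k : ℤ, x + k * p ∈ L.lattice
    · obtain ⟨k, hk⟩ := hx
      have h6 : (fun z ↦ F (z + x)) = F := by
        funext z
        rw [← hshift k (z + x), add_assoc]
        exact hper z _ hk
      have h7 : meromorphicOrderAt (fun z ↦ F (z + x)) 0 = meromorphicOrderAt F (0 + x) :=
        meromorphicOrderAt_comp_add_const_eq_meromorphicOrderAt (f := F)
      rw [h6, zero_add] at h7
      rwa [← h7]
    · push Not at hx
      rw [hord]
      exact Finset.sum_nonneg fun j _ ↦
        L.order_weierstrassP_sub_const_nonneg c (by simpa using hx j)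
  obtain ⟨d, hd⟩ := L.exists_eventually_eq_const hFmer hper hnonneg
  have hd0 : d ≠ 0 := by
    rintro rfl
    have h8 : meromorphicOrderAt F 0 = ⊤ := meromorphicOrderAt_eq_top_iff.mpr (hd 0)
    rw [hord, WithTop.sum_eq_top] at h8
    obtain ⟨j, -, hj⟩ := h8
    exact L.order_weierstrassP_sub_const_ne_top c _ hj
  refine ⟨⟨d, hd0, hd⟩, ?_⟩
  have h9 := hord 0
  classical
  rw [meromorphicOrderAt_congr (f₂ := fun _ ↦ d) (hd 0), meromorphicOrderAt_const, if_neg hd0] at h9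
  simpa using h9.symm

/-- `℘` separates the multiples of a division point up to sign. -/
lemma weierstrassP_mul_ne {N : ℕ} {p : ℂ} (hp : ∀ j : ℤ, (j : ℂ) * p ∈ L.lattice ↔ (N : ℤ) ∣ j)
    {a b : ℕ} (ha : 0 < a) (hab : a < b) (hb : 2 * b < N) :
    L.weierstrassP (a * p) ≠ L.weierstrassP (b * p) := by
  intro h
  set c := L.weierstrassP (a * p) with hc
  have hnot : ∀ j : ℕ, 0 < j → j < N → (j : ℂ) * p ∉ L.lattice := by
    intro j hj hjN hmem
    have := (hp j).mp (by simpa using hmem)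
    exact absurd (Nat.le_of_dvd hj (by exact_mod_cast this)) (by omega)
  have hneg : ∀ j : ℕ, j ≤ N → L.weierstrassP ((N - j : ℕ) * p) = L.weierstrassP (j * p) := by
    intro j hj
    have hN : (N : ℂ) * p ∈ L.lattice := by simpa using (hp N).mpr dvd_rfl
    have := L.weierstrassP_add_coe (-(j * p)) ⟨_, hN⟩
    rw [L.weierstrassP_neg] at this
    rw [← this]
    congr 1
    push_cast [Nat.cast_sub hj]; ring
  let d : ℕ → ℤ := fun j ↦ (if j = 0 then -2 else 0) + (if j = a then 1 else 0) +
    (if j = b then 1 else 0) + (if j = N - a then 1 else 0) + (if j = N - b then 1 else 0)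
  have hd : ∀ j ∈ Finset.range N, ((d j : ℤ) : WithTop ℤ) ≤
      meromorphicOrderAt (fun z ↦ L.weierstrassP z - c) ((j : ℂ) * p) := by
    intro j hj
    rw [Finset.mem_range] at hj
    by_cases h0 : j = 0
    · subst h0
      rw [L.order_weierstrassP_sub_const c (by simp)]
      have : d 0 = -2 := by
        simp only [d]; split_ifs <;> omega
      rw [this]; rfl
    have hjL := hnot j (by omega) hj
    have key : L.weierstrassP (j * p) = c → d j ≤ 1 → ((d j : ℤ) : WithTop ℤ) ≤
        meromorphicOrderAt (fun z ↦ L.weierstrassP z - c) ((j : ℂ) * p) := fun h1 h2 ↦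
      le_trans (by exact_mod_cast h2) (L.one_le_order_weierstrassP_sub_const hjL h1)
    by_cases h1 : j = a
    · refine key (by rw [h1]) ?_
      simp only [d]; split_ifs <;> omega
    by_cases h2 : j = b
    · refine key (by rw [h2, h]) ?_
      simp only [d]; split_ifs <;> omega
    by_cases h3 : j = N - a
    · refine key (by rw [h3, hneg a (by omega)]) ?_
      simp only [d]; split_ifs <;> omega
    by_cases h4 : j = N - b
    · refine key (by rw [h4, hneg b (by omega), h]) ?_
      simp only [d]; split_ifs <;> omega
    · refine le_trans ?_ (L.order_weierstrassP_sub_const_nonneg c hjL)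
      have : d j = 0 := by simp [d, h0, h1, h2, h3, h4]
      rw [this]; rfl
  have hsum : ∑ j ∈ Finset.range N, d j = 2 := by
    simp only [d, Finset.sum_add_distrib, Finset.sum_ite_eq', Finset.mem_range]
    rw [if_pos, if_pos, if_pos, if_pos, if_pos] <;> omega
  have hle : (2 : WithTop ℤ) ≤ ∑ j ∈ Finset.range N,
      meromorphicOrderAt (fun z ↦ L.weierstrassP z - c) ((j : ℂ) * p) := by
    refine le_trans (le_of_eq ?_) (Finset.sum_le_sum hd)
    rw [← WithTop.coe_sum, hsum]; rfl
  have hz := (L.prod_translates hp c (le_trans (by exact_mod_cast (by norm_num : (0:ℤ) ≤ 2)) hle)).2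
  rw [hz] at hle
  exact absurd hle (by exact_mod_cast (by norm_num : ¬ (2 : ℤ) ≤ 0))

/-- Translation by a point of order two acts on `℘` by an involution. -/
lemma weierstrassP_translate {w : ℂ} (hw : w ∉ L.lattice) (h2w : 2 * w ∈ L.lattice) :
    ∃ d ≠ 0, ∀ z, z ∉ L.lattice → z + w ∉ L.lattice →
      (L.weierstrassP (z + w) - L.weierstrassP w) * (L.weierstrassP z - L.weierstrassP w) = d := by
  have hp : ∀ j : ℤ, (j : ℂ) * w ∈ L.lattice ↔ ((2 : ℕ) : ℤ) ∣ j := by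
    intro j
    have heven : ∀ k : ℤ, ((2 * k : ℤ) : ℂ) * w ∈ L.lattice := fun k ↦ by
      have := L.lattice.smul_mem k h2w
      rw [zsmul_eq_mul] at this
      convert this using 1
      push_cast; ring
    constructor
    · intro hj
      by_contra hodd
      obtain ⟨k, rfl⟩ : Odd j := by
        rw [← Int.not_even_iff_odd, even_iff_two_dvd]; exact_mod_cast hodd
      apply hw
      have := L.lattice.sub_mem hj (heven k)
      convert this using 1
      push_cast; ring
    · rintro ⟨k, rfl⟩
      exact_mod_cast heven k
  obtain ⟨⟨d, hd0, hd⟩, -⟩ := L.prod_translates hp (L.weierstrassP w) (by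
    rw [Finset.sum_range_succ, Finset.sum_range_one, L.order_weierstrassP_sub_const _ (by simp)]
    have := L.two_le_order_weierstrassP_sub_const hw h2w rfl
    simp only [Nat.cast_one, one_mul]
    refine le_trans ?_ (add_le_add (le_refl (-2 : WithTop ℤ)) this)
    exact WithTop.coe_le_coe.mpr (by norm_num : (0 : ℤ) ≤ -2 + 2))
  refine ⟨d, hd0, fun z hz hzw ↦ ?_⟩
  have hc : ContinuousAt (fun z ↦ (L.weierstrassP (z + w) - L.weierstrassP w) *
      (L.weierstrassP z - L.weierstrassP w)) z := by
    have h1 : ContinuousAt L.weierstrassP (z + w) :=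
      (L.analyticOnNhd_weierstrassP _ hzw).continuousAt
    have h2 : ContinuousAt L.weierstrassP z := (L.analyticOnNhd_weierstrassP _ hz).continuousAt
    have h3 : ContinuousAt (fun z ↦ L.weierstrassP (z + w)) z :=
      ContinuousAt.comp (f := fun z ↦ z + w) (g := L.weierstrassP) h1 (by fun_prop)
    exact (h3.sub continuousAt_const).mul (h2.sub continuousAt_const)
  refine tendsto_nhds_unique (hc.tendsto.mono_left (nhdsWithin_le_nhds (s := {z}ᶜ))) ?_
  refine tendsto_const_nhds.congr' ?_
  filter_upwards [hd z] with x hx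
  rw [← hx]
  simp [Finset.prod_range_succ, mul_comm]

lemma hasSum_of_eq {ι : Type*} {f g : ι → ℂ} {a : ℂ} (h : HasSum g a) (hfg : ∀ i, f i = g i) :
    HasSum f a := by
  rwa [funext hfg]

/-- Splitting a sum over a lattice into the sums over the two cosets of a sublattice of index two. -/
lemma hasSum_lattice_of_index_two {L L' : PeriodPair} {w : ℂ} (hw : w ∉ L.lattice)
    (hL' : ∀ z, z ∈ L'.lattice ↔ z ∈ L.lattice ∨ z + w ∈ L.lattice) {f : ℂ → ℂ} {a b : ℂ}
    (ha : HasSum (fun l : L.lattice ↦ f l) a) (hb : HasSum (fun l : L.lattice ↦ f (l - w)) b) :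
    HasSum (fun l : L'.lattice ↦ f l) (a + b) := by
  have hset : (L'.lattice : Set ℂ) =
      (L.lattice : Set ℂ) ∪ (fun l ↦ l - w) '' (L.lattice : Set ℂ) := by
    ext z
    simp only [SetLike.mem_coe, Set.mem_union, Set.mem_image, hL']
    refine or_congr Iff.rfl ⟨fun h ↦ ⟨z + w, h, by ring⟩, ?_⟩
    rintro ⟨l, hl, rfl⟩
    simpa using hl
  have hdisj : Disjoint (L.lattice : Set ℂ) ((fun l ↦ l - w) '' (L.lattice : Set ℂ)) := by
    rw [Set.disjoint_left]
    rintro _ h ⟨l, hl, rfl⟩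
    exact hw (by simpa using L.lattice.sub_mem hl h)
  have hb' : HasSum (f ∘ ((↑) : ((fun l ↦ l - w) '' (L.lattice : Set ℂ)) → ℂ)) b := by
    rw [← (Equiv.Set.image (fun l ↦ l - w) (L.lattice : Set ℂ) (sub_left_injective)).hasSum_iff]
    exact hb
  have h := HasSum.add_disjoint hdisj (f := f) ha hb'
  rw [← hset] at h
  exact h

lemma weierstrassP_of_index_two {L L' : PeriodPair} {w : ℂ} (hw : w ∉ L.lattice)
    (hL' : ∀ z, z ∈ L'.lattice ↔ z ∈ L.lattice ∨ z + w ∈ L.lattice) (z : ℂ) :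
    L'.weierstrassP z = L.weierstrassP z + L.weierstrassP (z + w) - L.weierstrassP w := by
  rw [add_sub_assoc]
  refine (L'.hasSum_weierstrassP z).unique
    (hasSum_lattice_of_index_two hw hL' (f := fun l ↦ 1 / (z - l) ^ 2 - 1 / l ^ 2)
      (L.hasSum_weierstrassP z) ?_)
  refine hasSum_of_eq ((L.hasSum_weierstrassP (z + w)).sub (L.hasSum_weierstrassP w)) fun l ↦ ?_
  rw [show z - (l - w) = z + w - l by ring, show ((l : ℂ) - w) ^ 2 = (w - l) ^ 2 by ring]
  ring

lemma derivWeierstrassP_of_index_two {L L' : PeriodPair} {w : ℂ} (hw : w ∉ L.lattice)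
    (hL' : ∀ z, z ∈ L'.lattice ↔ z ∈ L.lattice ∨ z + w ∈ L.lattice) (z : ℂ) :
    L'.derivWeierstrassP z = L.derivWeierstrassP z + L.derivWeierstrassP (z + w) := by
  refine (L'.hasSum_derivWeierstrassP z).unique
    (hasSum_lattice_of_index_two hw hL' (f := fun l ↦ -2 / (z - l) ^ 3)
      (L.hasSum_derivWeierstrassP z) ?_)
  refine hasSum_of_eq (L.hasSum_derivWeierstrassP (z + w)) fun l ↦ ?_
  rw [show z - (l - w) = z + w - l by ring]

/-- The bijection between two lattices, one of which is a multiple of the other. -/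
noncomputable def latticeEquivOfMul {L L' : PeriodPair} {α : ℂ} (hα : α ≠ 0)
    (h : ∀ z, z ∈ L'.lattice ↔ α * z ∈ L.lattice) : L'.lattice ≃ L.lattice where
  toFun l := ⟨α * l, (h l).mp l.2⟩
  invFun l := ⟨α⁻¹ * l, (h _).mpr (by simp [hα])⟩
  left_inv l := by ext; simp [hα]
  right_inv l := by ext; simp [hα]

lemma weierstrassP_of_mul {L L' : PeriodPair} {α : ℂ} (hα : α ≠ 0)
    (h : ∀ z, z ∈ L'.lattice ↔ α * z ∈ L.lattice) (z : ℂ) :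
    L'.weierstrassP z = α ^ 2 * L.weierstrassP (α * z) := by
  refine (L'.hasSum_weierstrassP z).unique ?_
  have := (latticeEquivOfMul hα h).hasSum_iff.mpr
    ((L.hasSum_weierstrassP (α * z)).mul_left (α ^ 2))
  refine hasSum_of_eq (this) fun l ↦ ?_
  simp only [Function.comp_apply, latticeEquivOfMul, Equiv.coe_fn_mk]
  rw [← mul_sub, mul_pow, mul_pow, mul_sub, one_div, one_div, one_div, one_div, mul_inv, mul_inv,
    mul_inv_cancel_left₀ (pow_ne_zero 2 hα), mul_inv_cancel_left₀ (pow_ne_zero 2 hα)]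

lemma derivWeierstrassP_of_mul {L L' : PeriodPair} {α : ℂ} (hα : α ≠ 0)
    (h : ∀ z, z ∈ L'.lattice ↔ α * z ∈ L.lattice) (z : ℂ) :
    L'.derivWeierstrassP z = α ^ 3 * L.derivWeierstrassP (α * z) := by
  refine (L'.hasSum_derivWeierstrassP z).unique ?_
  have := (latticeEquivOfMul hα h).hasSum_iff.mpr
    ((L.hasSum_derivWeierstrassP (α * z)).mul_left (α ^ 3))
  refine hasSum_of_eq (this) fun l ↦ ?_
  simp only [Function.comp_apply, latticeEquivOfMul, Equiv.coe_fn_mk]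
  rw [← mul_sub, mul_pow, div_eq_mul_inv, div_eq_mul_inv, mul_inv, mul_left_comm (α ^ 3),
    mul_inv_cancel_left₀ (pow_ne_zero 3 hα)]

lemma weierstrassP_ne_of_two_mul_mem {w z : ℂ} (hw : w ∉ L.lattice) (h2w : 2 * w ∈ L.lattice)
    (hz : z ∉ L.lattice) (hzw : z + w ∉ L.lattice) : L.weierstrassP z ≠ L.weierstrassP w := by
  obtain ⟨d, hd, h⟩ := L.weierstrassP_translate hw h2w
  intro h'
  apply hd
  rw [← h z hz hzw, h', sub_self, mul_zero]

/-- The first finite branch value of `℘`. -/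
noncomputable def e₁ : ℂ := L.weierstrassP (L.ω₁ / 2)
/-- The second finite branch value of `℘`. -/
noncomputable def e₂ : ℂ := L.weierstrassP ((L.ω₁ + L.ω₂) / 2)
/-- The third finite branch value of `℘`. -/
noncomputable def e₃ : ℂ := L.weierstrassP (L.ω₂ / 2)

lemma ω₁_add_ω₂_div_two_notMem_lattice : (L.ω₁ + L.ω₂) / 2 ∉ L.lattice := by
  have := (L.mul_ω₁_add_mul_ω₂_mem_lattice (α := 1 / 2) (β := 1 / 2)).not.mpr (by norm_num)
  convert this using 2
  push_cast; ring

lemma two_mul_ω₁_mem : 2 * (L.ω₁ / 2) ∈ L.lattice := by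
  simpa [mul_div_cancel₀] using L.ω₁_mem_lattice

lemma two_mul_ω₂_mem : 2 * (L.ω₂ / 2) ∈ L.lattice := by
  simpa [mul_div_cancel₀] using L.ω₂_mem_lattice

lemma two_mul_ω₁_add_ω₂_mem : 2 * ((L.ω₁ + L.ω₂) / 2) ∈ L.lattice := by
  simpa [mul_div_cancel₀] using L.lattice.add_mem L.ω₁_mem_lattice L.ω₂_mem_lattice

lemma e₁_ne_e₃ : L.e₁ ≠ L.e₃ := by
  refine L.weierstrassP_ne_of_two_mul_mem L.ω₂_div_two_notMem_lattice L.two_mul_ω₂_mem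
    L.ω₁_div_two_notMem_lattice ?_
  rw [← add_div]; exact L.ω₁_add_ω₂_div_two_notMem_lattice

lemma e₁_ne_e₂ : L.e₁ ≠ L.e₂ := by
  refine L.weierstrassP_ne_of_two_mul_mem L.ω₁_add_ω₂_div_two_notMem_lattice
    L.two_mul_ω₁_add_ω₂_mem L.ω₁_div_two_notMem_lattice fun h ↦ L.ω₂_div_two_notMem_lattice ?_
  convert L.lattice.sub_mem h L.ω₁_mem_lattice using 1
  ring

lemma e₂_ne_e₃ : L.e₂ ≠ L.e₃ := by
  refine L.weierstrassP_ne_of_two_mul_mem L.ω₂_div_two_notMem_lattice L.two_mul_ω₂_mem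
    L.ω₁_add_ω₂_div_two_notMem_lattice fun h ↦ L.ω₁_div_two_notMem_lattice ?_
  convert L.lattice.sub_mem h L.ω₂_mem_lattice using 1
  ring

lemma cubic_eq_zero {w : ℂ} (hw : w ∉ L.lattice) (h2w : 2 * w ∈ L.lattice) :
    4 * L.weierstrassP w ^ 3 - L.g₂ * L.weierstrassP w - L.g₃ = 0 := by
  rw [← L.derivWeierstrassP_sq w hw, L.derivWeierstrassP_eq_zero h2w]
  ring

lemma e_relations : L.e₁ + L.e₂ + L.e₃ = 0 ∧
    ∀ x, 4 * x ^ 3 - L.g₂ * x - L.g₃ = 4 * (x - L.e₁) * (x - L.e₂) * (x - L.e₃) := by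
  have h1 : 4 * L.e₁ ^ 3 - L.g₂ * L.e₁ - L.g₃ = 0 :=
    L.cubic_eq_zero L.ω₁_div_two_notMem_lattice L.two_mul_ω₁_mem
  have h2 : 4 * L.e₂ ^ 3 - L.g₂ * L.e₂ - L.g₃ = 0 :=
    L.cubic_eq_zero L.ω₁_add_ω₂_div_two_notMem_lattice L.two_mul_ω₁_add_ω₂_mem
  have h3 : 4 * L.e₃ ^ 3 - L.g₂ * L.e₃ - L.g₃ = 0 :=
    L.cubic_eq_zero L.ω₂_div_two_notMem_lattice L.two_mul_ω₂_mem
  have h12 : L.g₂ = 4 * (L.e₁ ^ 2 + L.e₁ * L.e₂ + L.e₂ ^ 2) := by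
    refine mul_left_cancel₀ (sub_ne_zero.mpr L.e₁_ne_e₂) ?_
    linear_combination h2 - h1
  have h13 : L.g₂ = 4 * (L.e₁ ^ 2 + L.e₁ * L.e₃ + L.e₃ ^ 2) := by
    refine mul_left_cancel₀ (sub_ne_zero.mpr L.e₁_ne_e₃) ?_
    linear_combination h3 - h1
  have h0 : L.e₁ + L.e₂ + L.e₃ = 0 := by
    refine mul_left_cancel₀ (sub_ne_zero.mpr L.e₂_ne_e₃) ?_
    linear_combination (h13 - h12) / 4
  refine ⟨h0, fun x ↦ ?_⟩
  have he3 : L.e₃ = -L.e₁ - L.e₂ := by linear_combination h0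
  rw [he3]
  linear_combination (L.e₁ - x) * h12 + h1

/-- The pair of periods obtained by halving the first one. -/
noncomputable def half : PeriodPair where
  ω₁ := L.ω₁ / 2
  ω₂ := L.ω₂
  indep := by
    have h := L.indep
    rw [LinearIndependent.pair_iff] at h ⊢
    intro s t hst
    have := h (s / 2) t (by
      rw [← hst]; simp only [Complex.real_smul]; push_cast; ring)
    simpa using this

lemma ω₁_half : L.half.ω₁ = L.ω₁ / 2 := rfl
lemma ω₂_half : L.half.ω₂ = L.ω₂ := rfl

lemma mem_lattice_half (z : ℂ) :
    z ∈ L.half.lattice ↔ z ∈ L.lattice ∨ z + L.ω₁ / 2 ∈ L.lattice := by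
  simp only [mem_lattice, ω₁_half, ω₂_half]
  constructor
  · rintro ⟨m, n, rfl⟩
    obtain ⟨k, rfl | rfl⟩ := m.even_or_odd'
    · exact Or.inl ⟨k, n, by push_cast; ring⟩
    · exact Or.inr ⟨k + 1, n, by push_cast; ring⟩
  · rintro (⟨m, n, rfl⟩ | ⟨m, n, h⟩)
    · exact ⟨2 * m, n, by push_cast; ring⟩
    · exact ⟨2 * m - 1, n, by push_cast; linear_combination h⟩

/-- The difference `℘(ω₁ / 4) - e₁`. -/
noncomputable def quarterDiff : ℂ := L.weierstrassP (L.ω₁ / 4) - L.e₁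

lemma ω₁_div_four_notMem : L.ω₁ / 4 ∉ L.lattice := fun h ↦ L.ω₁_div_two_notMem_lattice (by
  convert L.lattice.add_mem h h using 1
  ring)

lemma translate_ω₁ {z : ℂ} (hz : z ∉ L.lattice) (hz' : z + L.ω₁ / 2 ∉ L.lattice) :
    (L.weierstrassP (z + L.ω₁ / 2) - L.e₁) * (L.weierstrassP z - L.e₁) = L.quarterDiff ^ 2 := by
  obtain ⟨d, -, h⟩ := L.weierstrassP_translate L.ω₁_div_two_notMem_lattice L.two_mul_ω₁_mem
  have h1 : L.weierstrassP (L.ω₁ / 4 + L.ω₁ / 2) = L.weierstrassP (L.ω₁ / 4) := by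
    have h := L.weierstrassP_add_coe (-(L.ω₁ / 4)) ⟨_, L.ω₁_mem_lattice⟩
    rw [L.weierstrassP_neg] at h
    rw [← h]
    congr 1; ring
  have h2 := h (L.ω₁ / 4) L.ω₁_div_four_notMem fun h' ↦ L.ω₁_div_four_notMem (by
    convert L.lattice.sub_mem L.ω₁_mem_lattice h' using 1; ring)
  rw [h1] at h2
  rw [e₁, h z hz hz', ← h2, quarterDiff, e₁, sq]

lemma quarterDiff_sq : L.quarterDiff ^ 2 = (L.e₁ - L.e₃) * (L.e₁ - L.e₂) := by
  have h12 : L.ω₂ / 2 + L.ω₁ / 2 = (L.ω₁ + L.ω₂) / 2 := by ring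
  rw [← L.translate_ω₁ L.ω₂_div_two_notMem_lattice
    (by rw [h12]; exact L.ω₁_add_ω₂_div_two_notMem_lattice), h12, e₁, e₂, e₃]
  ring

lemma quarterDiff_ne_zero : L.quarterDiff ≠ 0 := by
  refine pow_ne_zero_iff two_ne_zero |>.mp ?_
  rw [quarterDiff_sq]
  exact mul_ne_zero (sub_ne_zero.mpr L.e₁_ne_e₃) (sub_ne_zero.mpr L.e₁_ne_e₂)

lemma deriv_translate_ω₁ {z : ℂ} (hz : z ∉ L.lattice) (hz' : z + L.ω₁ / 2 ∉ L.lattice) :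
    L.derivWeierstrassP (z + L.ω₁ / 2) * (L.weierstrassP z - L.e₁) +
      (L.weierstrassP (z + L.ω₁ / 2) - L.e₁) * L.derivWeierstrassP z = 0 := by
  have hd : ∀ x, x ∉ L.lattice → HasDerivAt L.weierstrassP (L.derivWeierstrassP x) x := by
    intro x hx
    rw [← L.deriv_weierstrassP]
    exact (L.analyticOnNhd_weierstrassP x hx).differentiableAt.hasDerivAt
  have h1 := ((hd _ hz').comp_add_const z (L.ω₁ / 2)).sub_const L.e₁
  have h2 := (h1.mul ((hd _ hz).sub_const L.e₁))
  have hev : ∀ᶠ x in 𝓝 z, x ∉ L.lattice ∧ x + L.ω₁ / 2 ∉ L.lattice :=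
    (L.isClosed_lattice.isOpen_compl.eventually_mem hz).and
      ((continuous_id.add continuous_const).continuousAt.eventually
        (L.isClosed_lattice.isOpen_compl.eventually_mem hz'))
  have h3 : HasDerivAt (fun x ↦ (L.weierstrassP (x + L.ω₁ / 2) - L.e₁) *
      (L.weierstrassP x - L.e₁)) 0 z := by
    refine (hasDerivAt_const z (L.quarterDiff ^ 2)).congr_of_eventuallyEq ?_
    filter_upwards [hev] with x hx
    exact L.translate_ω₁ hx.1 hx.2
  exact h2.unique h3

/-- The modular parameter `u`, for which the quotient of `ω₁ / 2` has an integral model. -/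
noncomputable def modU : ℂ := (L.quarterDiff / (L.e₁ - L.e₃) - 1) / 8

lemma quarterDiff_eq : L.quarterDiff = (1 + 8 * L.modU) * (L.e₁ - L.e₃) := by
  have := sub_ne_zero.mpr L.e₁_ne_e₃
  rw [modU]; field_simp; ring

lemma e₁_sub_e₂ : L.e₁ - L.e₂ = (1 + 8 * L.modU) ^ 2 * (L.e₁ - L.e₃) := by
  have h := L.quarterDiff_sq
  rw [quarterDiff_eq] at h
  refine mul_left_cancel₀ (sub_ne_zero.mpr L.e₁_ne_e₃) ?_
  rw [← h]; ring

lemma modU_ne_zero : L.modU ≠ 0 := by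
  intro h
  have := L.e₁_sub_e₂
  rw [h] at this
  exact L.e₂_ne_e₃ (by linear_combination -this)

lemma one_add_eight_modU_ne_zero : 1 + 8 * L.modU ≠ 0 := by
  intro h
  have := L.quarterDiff_eq
  rw [h, zero_mul] at this
  exact L.quarterDiff_ne_zero this

lemma weierstrassP_half {z : ℂ} (hz : z ∉ L.lattice) (hz' : z + L.ω₁ / 2 ∉ L.lattice) :
    (L.half.weierstrassP z - L.weierstrassP z) * (L.weierstrassP z - L.e₁) = L.quarterDiff ^ 2 := by
  rw [weierstrassP_of_index_two L.ω₁_div_two_notMem_lattice L.mem_lattice_half,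
    ← L.translate_ω₁ hz hz', e₁]
  ring

lemma derivWeierstrassP_half {z : ℂ} (hz : z ∉ L.lattice) (hz' : z + L.ω₁ / 2 ∉ L.lattice) :
    L.half.derivWeierstrassP z * (L.weierstrassP z - L.e₁) ^ 2 =
      L.derivWeierstrassP z * ((L.weierstrassP z - L.e₁) ^ 2 - L.quarterDiff ^ 2) := by
  rw [derivWeierstrassP_of_index_two L.ω₁_div_two_notMem_lattice L.mem_lattice_half,
    ← L.translate_ω₁ hz hz']
  linear_combination (L.weierstrassP z - L.e₁) * L.deriv_translate_ω₁ hz hz'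

lemma e₁_half : L.half.e₁ = L.e₁ + 2 * L.quarterDiff := by
  have h1 : L.weierstrassP (L.ω₁ / 4 + L.ω₁ / 2) = L.weierstrassP (L.ω₁ / 4) := by
    have h := L.weierstrassP_add_coe (-(L.ω₁ / 4)) ⟨_, L.ω₁_mem_lattice⟩
    rw [L.weierstrassP_neg] at h
    rw [← h]
    congr 1; ring
  rw [e₁, weierstrassP_of_index_two L.ω₁_div_two_notMem_lattice L.mem_lattice_half, ω₁_half,
    show L.ω₁ / 2 / 2 = L.ω₁ / 4 by ring, h1, quarterDiff, e₁]
  ring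

lemma e₃_half : L.half.e₃ = L.e₃ - (L.e₁ - L.e₂) := by
  rw [e₃, weierstrassP_of_index_two L.ω₁_div_two_notMem_lattice L.mem_lattice_half, ω₂_half,
    show L.ω₂ / 2 + L.ω₁ / 2 = (L.ω₁ + L.ω₂) / 2 by ring, e₁, e₂, e₃]
  ring

lemma e₁_sub_e₃_half : L.half.e₁ - L.half.e₃ = 4 * (1 + 4 * L.modU) ^ 2 * (L.e₁ - L.e₃) := by
  rw [e₁_half, e₃_half, e₁_sub_e₂, quarterDiff_eq]
  ring

/-- The Landen transformation of the parameter `u`. -/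
lemma modU_half : L.modU ^ 2 =
    -L.half.modU * (1 + 4 * L.half.modU) * (1 + 4 * L.modU) ^ 2 := by
  have h0 := sub_ne_zero.mpr L.e₁_ne_e₃
  have h1 := L.half.e₁_sub_e₂
  rw [e₁_sub_e₃_half] at h1
  have h2 : L.half.e₁ - L.half.e₂ = 4 * L.quarterDiff := by
    have h3 := L.half.e_relations.1
    have h4 := L.e_relations.1
    rw [e₃_half] at h3
    have h5 := L.e₁_half
    linear_combination 2 * h5 - h3 + h4
  rw [h2, quarterDiff_eq] at h1
  refine mul_left_cancel₀ h0 ?_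
  linear_combination -h1 / 64

/-- A normalised abscissa with poles at the third point of order two. -/
noncomputable def absc (z : ℂ) : ℂ := -4 * (L.e₁ - L.e₃) / (L.weierstrassP z - L.e₃)

/-- The ordinate belonging to `absc`, up to a scalar. -/
noncomputable def ordi (z : ℂ) : ℂ :=
  2 * Complex.I * L.derivWeierstrassP z / (L.weierstrassP z - L.e₃) ^ 2

lemma notMem_of_two_mul_notMem {z w : ℂ} (hz : 2 * z ∉ L.lattice) (hw : 2 * w ∈ L.lattice) :
    z + w ∉ L.lattice := fun h ↦ hz (by
  convert L.lattice.sub_mem (L.lattice.add_mem h h) hw using 1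
  ring)

lemma weierstrassP_ne_of_two_mul_notMem {z w : ℂ} (hz : 2 * z ∉ L.lattice) (hw : w ∉ L.lattice)
    (h2w : 2 * w ∈ L.lattice) : L.weierstrassP z - L.weierstrassP w ≠ 0 :=
  sub_ne_zero.mpr <| L.weierstrassP_ne_of_two_mul_mem hw h2w
    (by simpa using L.notMem_of_two_mul_notMem hz (w := 0) (by simp))
    (L.notMem_of_two_mul_notMem hz h2w)

lemma weierstrassP_sub_e_ne_zero {z : ℂ} (hz : 2 * z ∉ L.lattice) :
    L.weierstrassP z - L.e₁ ≠ 0 ∧ L.weierstrassP z - L.e₂ ≠ 0 ∧ L.weierstrassP z - L.e₃ ≠ 0 :=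
  ⟨L.weierstrassP_ne_of_two_mul_notMem hz L.ω₁_div_two_notMem_lattice L.two_mul_ω₁_mem,
    L.weierstrassP_ne_of_two_mul_notMem hz L.ω₁_add_ω₂_div_two_notMem_lattice
      L.two_mul_ω₁_add_ω₂_mem,
    L.weierstrassP_ne_of_two_mul_notMem hz L.ω₂_div_two_notMem_lattice L.two_mul_ω₂_mem⟩

lemma absc_ne_zero {z : ℂ} (hz : 2 * z ∉ L.lattice) : L.absc z ≠ 0 :=
  div_ne_zero (mul_ne_zero (by norm_num) (sub_ne_zero.mpr L.e₁_ne_e₃))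
    (L.weierstrassP_sub_e_ne_zero hz).2.2

lemma e₂_eq : L.e₂ = L.e₁ - (1 + 8 * L.modU) ^ 2 * (L.e₁ - L.e₃) := by
  linear_combination -L.e₁_sub_e₂

lemma one_sub_absc {z : ℂ} (hz : 2 * z ∉ L.lattice) :
    1 - 4 * (L.modU * (1 + 4 * L.modU)) * L.absc z =
      (L.weierstrassP z - L.e₂) / (L.weierstrassP z - L.e₃) := by
  have h3 := (L.weierstrassP_sub_e_ne_zero hz).2.2
  rw [absc, e₂_eq]
  field_simp
  ring

/-- The Weierstrass equation satisfied by the normalised coordinates. -/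
lemma ordi_sq {z : ℂ} (hz : 2 * z ∉ L.lattice) :
    (L.e₁ - L.e₃) * L.ordi z ^ 2 =
      L.absc z * (L.absc z + 4) * (1 - 4 * (L.modU * (1 + 4 * L.modU)) * L.absc z) := by
  obtain ⟨h1, h2, h3⟩ := L.weierstrassP_sub_e_ne_zero hz
  have hz0 : z ∉ L.lattice := by simpa using L.notMem_of_two_mul_notMem hz (w := 0) (by simp)
  have h := L.derivWeierstrassP_sq z hz0
  rw [L.e_relations.2] at h
  rw [L.one_sub_absc hz, absc, ordi]
  field_simp
  rw [Complex.I_sq, h]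
  ring

lemma weierstrassP_half_sub {z : ℂ} (hz : 2 * z ∉ L.lattice) :
    L.half.weierstrassP z - L.half.e₃ = (L.weierstrassP z - L.e₃) *
      (L.weierstrassP z - L.e₂) / (L.weierstrassP z - L.e₁) := by
  obtain ⟨h1, h2, h3⟩ := L.weierstrassP_sub_e_ne_zero hz
  have hz0 : z ∉ L.lattice := by simpa using L.notMem_of_two_mul_notMem hz (w := 0) (by simp)
  have h := L.weierstrassP_half hz0 (L.notMem_of_two_mul_notMem hz L.two_mul_ω₁_mem)
  rw [quarterDiff_sq] at h
  rw [e₃_half, eq_div_iff h1]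
  linear_combination h

lemma absc_half {z : ℂ} (hz : 2 * z ∉ L.lattice) :
    L.half.absc z * (1 - 4 * (L.modU * (1 + 4 * L.modU)) * L.absc z) =
      (1 + 4 * L.modU) ^ 2 * L.absc z * (L.absc z + 4) := by
  obtain ⟨h1, h2, h3⟩ := L.weierstrassP_sub_e_ne_zero hz
  rw [L.one_sub_absc hz, absc, absc, L.weierstrassP_half_sub hz, L.e₁_sub_e₃_half]
  field_simp
  ring

lemma ordi_half {z : ℂ} (hz : 2 * z ∉ L.lattice) :
    2 * L.half.ordi z * (1 - 4 * (L.modU * (1 + 4 * L.modU)) * L.absc z) ^ 2 =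
      L.ordi z * (2 + (1 + 4 * L.modU) * L.absc z) * (1 - 2 * L.modU * L.absc z) := by
  obtain ⟨h1, h2, h3⟩ := L.weierstrassP_sub_e_ne_zero hz
  have hz0 : z ∉ L.lattice := by simpa using L.notMem_of_two_mul_notMem hz (w := 0) (by simp)
  have h := L.derivWeierstrassP_half hz0 (L.notMem_of_two_mul_notMem hz L.two_mul_ω₁_mem)
  rw [← eq_div_iff (pow_ne_zero 2 h1), quarterDiff_eq] at h
  rw [L.one_sub_absc hz, absc, ordi, ordi, L.weierstrassP_half_sub hz, h]
  field_simp
  ring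

end PeriodPair

section Valuation

variable {C Γ : Type*} [Field C] [LinearOrderedCommGroupWithZero Γ] (v : Valuation C Γ)

/-- Valuation cannot strictly decrease around a cycle. -/
lemma not_forall_lt_of_periodic {Γ : Type*} [Preorder Γ] {f : ℕ → Γ} {m : ℕ} (hm : 0 < m) {i : ℕ}
    (hf : f (i + m) = f i) (h : ∀ j, f (i + (j + 1)) < f (i + j)) : False := by
  have : ∀ j, f (i + (j + 1)) < f i := by
    intro j
    induction j with
    | zero => exact h 0
    | succ j ih => exact (h (j + 1)).trans ih
  obtain ⟨n, rfl⟩ := Nat.exists_eq_succ_of_ne_zero hm.ne'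
  exact (this n).ne hf

lemma val_four_lt_one {v : Valuation C Γ} (h2 : v 2 < 1) : v 4 < 1 := by
  rw [show (4 : C) = 2 ^ 2 by norm_num, map_pow]
  exact pow_lt_one₀ zero_le h2 two_ne_zero

lemma val_one_add_mul {v : Valuation C Γ} {a b : C} (ha : v a < 1) (hb : v b ≤ 1) :
    v (1 + a * b) = 1 := by
  refine v.map_one_add_of_lt ?_
  rw [map_mul]
  exact mul_lt_one_of_lt_of_le ha hb

/-- A cycle of Landen transformations whose multiplier is a unit consists of units. -/
lemma val_modular_cycle (h20 : (2 : C) ≠ 0) (h2 : v 2 < 1) {m : ℕ} (hm : 0 < m) {u : ℕ → C}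
    (hper : ∀ i, u (i + m) = u i) (h0 : ∀ i, u i ≠ 0) (h80 : ∀ i, 1 + 8 * u i ≠ 0)
    (hR : ∀ i, u i ^ 2 = -u (i + 1) * (1 + 4 * u (i + 1)) * (1 + 4 * u i) ^ 2)
    (hprod : v (∏ i ∈ Finset.range m, (1 + 4 * u i)) = 1) (i : ℕ) : v (u i) = 1 := by
  have hk : ∀ i, v (1 + 8 * u (i + 1)) ^ 2 * v (1 + (1 + 8 * u i)) ^ 2 =
      v 4 * v (1 + 8 * u i) := fun i ↦ by
    rw [← map_pow, ← map_pow, ← map_mul, ← map_mul]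
    congr 1
    linear_combination 64 * hR i
  have h4 := val_four_lt_one h2
  have hv2 : 0 < v 2 := zero_lt_iff.mpr ((Valuation.ne_zero_iff _).mpr h20)
  have hkey : ∀ i, v (1 + (1 + 8 * u i)) = v 2 * v (1 + 4 * u i) := fun i ↦ by
    rw [← map_mul]; congr 1; ring
  have hlt : ∀ i, v (1 + 8 * u i) ≠ 1 → v (1 + 8 * u (i + 1)) < 1 := by
    intro i hi
    rw [← sq_lt_one_iff₀ zero_le]
    have hpos : 0 < v (1 + 8 * u i) := zero_lt_iff.mpr ((Valuation.ne_zero_iff _).mpr (h80 i))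
    rcases lt_or_gt_of_ne hi with h | h
    · have h1 := hk i
      rw [v.map_one_add_of_lt h, one_pow, mul_one] at h1
      rw [h1]
      exact mul_lt_one_of_lt_of_le h4 h.le
    · have h1 := hk i
      rw [v.map_add_eq_of_lt_right (x := 1) (y := 1 + 8 * u i) (by rwa [map_one])] at h1
      have h3 : v (1 + 8 * u (i + 1)) ^ 2 * v (1 + 8 * u i) = v 4 :=
        mul_right_cancel₀ hpos.ne' (by rw [← h1, sq (v (1 + 8 * u i)), mul_assoc])
      by_contra! h5
      exact absurd (h3 ▸ h4) (not_lt.mpr (one_le_mul h5 h.le))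
  have hk1 : ∀ i, v (1 + 8 * u i) = 1 := by
    intro i
    by_contra hne
    have hall : ∀ j, v (1 + 8 * u (i + 1 + j)) < 1 := by
      intro j
      induction j with
      | zero => exact hlt i hne
      | succ j ih => exact hlt _ ih.ne
    have hall' : ∀ j, v (1 + 8 * u j) < 1 := by
      intro j
      have hp : Function.Periodic u m := hper
      have h5 := hp.nat_mul (i + 1) j
      rw [← h5]
      have := hall (j + ((i + 1) * m - (i + 1)))
      have hle : i + 1 ≤ (i + 1) * m := Nat.le_mul_of_pos_right _ hm
      rwa [show i + 1 + (j + ((i + 1) * m - (i + 1))) = j + (i + 1) * m by omega] at this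
    have hbig : ∀ j, 1 < v (1 + 4 * u j) := by
      intro j
      have h6 := hkey j
      rw [v.map_one_add_of_lt (hall' j)] at h6
      by_contra! h7
      exact absurd h6.symm (mul_lt_one_of_lt_of_le h2 h7).ne
    rw [map_prod] at hprod
    refine absurd hprod (ne_of_gt ?_)
    clear hprod
    obtain ⟨n, rfl⟩ := Nat.exists_eq_succ_of_ne_zero hm.ne'
    clear hm hper
    induction n with
    | zero => simpa using hbig 0
    | succ n ih => rw [Finset.prod_range_succ]; exact one_lt_mul'' ih (hbig _)
  have h41 : ∀ i, v (1 + 4 * u i) = 1 := by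
    intro i
    have h6 := hk i
    rw [hk1, hk1, hkey, one_pow, one_mul, mul_one, show (4 : C) = 2 ^ 2 by norm_num, map_pow] at h6
    have h7 := (pow_left_inj₀ zero_le zero_le two_ne_zero).mp h6
    have : (2 : C) ^ 2 = 4 := by norm_num
    rw [this] at h7
    exact mul_left_cancel₀ hv2.ne' (by rw [h7, mul_one])
  have hsq : ∀ i, v (u (i + 1)) = v (u i) ^ 2 := by
    intro i
    rw [← map_pow, hR, map_mul, map_mul, map_pow, h41, h41, Valuation.map_neg]
    simp
  have hpow : ∀ j, v (u (i + j)) = v (u i) ^ 2 ^ j := by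
    intro j
    induction j with
    | zero => simp
    | succ j ih => rw [← add_assoc, hsq, ih, ← pow_mul, pow_succ]
  have hpos : v (u i) ≠ 0 := (Valuation.ne_zero_iff _).mpr (h0 i)
  have h8 := hpow m
  rw [hper] at h8
  have h9 : v (u i) ^ (2 ^ m - 1) = 1 := by
    refine mul_right_cancel₀ hpos ?_
    rw [← pow_succ, Nat.sub_add_cancel Nat.one_le_two_pow, one_mul, ← h8]
  exact (pow_eq_one_iff_of_nonneg zero_le
    (Nat.sub_ne_zero_of_lt (Nat.one_lt_two_pow hm.ne'))).mp h9

/-- A periodic orbit of the duality isogeny with good reduction consists of units. -/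
lemma val_absc_cycle (h2 : v 2 < 1) {m : ℕ} (hm : 0 < m) {u x : ℕ → C} (hu : ∀ i, v (u i) ≤ 1)
    (hper : ∀ i, x (i + m) = x i) (h0 : ∀ i, x i ≠ 0)
    (hx : ∀ i, x (i + 1) * (1 - 4 * (u i * (1 + 4 * u i)) * x i) =
      (1 + 4 * u i) ^ 2 * x i * (x i + 4)) (i : ℕ) : v (x i) = 1 := by
  have h4 := val_four_lt_one h2
  have h41 : ∀ i, v (1 + 4 * u i) = 1 := fun i ↦ val_one_add_mul h4 (hu i)
  have hxv : ∀ i, v (x (i + 1)) * v (1 - 4 * (u i * (1 + 4 * u i)) * x i) =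
      v (x i) * v (x i + 4) := fun i ↦ by
    rw [← map_mul, hx, map_mul, map_mul, map_pow, h41, one_pow, one_mul]
  have hpos : ∀ i, 0 < v (x i) := fun i ↦ zero_lt_iff.mpr ((Valuation.ne_zero_iff _).mpr (h0 i))
  have hw : ∀ i, v (4 * (u i * (1 + 4 * u i)) * x i) ≤ v 4 * v (x i) := fun i ↦ by
    rw [map_mul, map_mul, map_mul, h41, mul_one]
    exact mul_le_mul_left (mul_le_of_le_one_right' (hu i)) _
  by_contra hne
  rcases lt_or_gt_of_ne hne with hlt | hgt
  · have hstep : ∀ j, v (x j) < 1 → v (x (j + 1)) < v (x j) := by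
      intro j hj
      have h1 := hxv j
      rw [sub_eq_add_neg, v.map_one_add_of_lt, mul_one] at h1
      · rw [h1]
        exact mul_lt_of_lt_one_right (hpos j) (v.map_add_lt hj h4)
      · rw [Valuation.map_neg]
        exact (hw j).trans_lt (mul_lt_one_of_lt_of_le h4 hj.le)
    have hall : ∀ j, v (x (i + j)) < 1 := by
      intro j
      induction j with
      | zero => exact hlt
      | succ j ih => exact (hstep _ ih).trans ih
    exact not_forall_lt_of_periodic (f := fun j ↦ v (x j)) hm (congrArg v (hper i))
      fun j ↦ hstep _ (hall j)
  · have hstep : ∀ j, 1 < v (x j) → v (x j) < v (x (j + 1)) := by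
      intro j hj
      have h1 := hxv j
      rw [v.map_add_eq_of_lt_left (h4.trans hj)] at h1
      have h3 : v (1 - 4 * (u j * (1 + 4 * u j)) * x j) < v (x j) := by
        refine v.map_sub_lt (by rwa [map_one]) ((hw j).trans_lt ?_)
        exact mul_lt_of_lt_one_left (hpos j) h4
      by_contra! h5
      have h6 : v (x (j + 1)) * v (1 - 4 * (u j * (1 + 4 * u j)) * x j) < v (x j) * v (x j) :=
        mul_lt_mul' h5 h3 zero_le (hpos j)
      exact h6.ne h1
    have hall : ∀ j, 1 < v (x (i + j)) := by
      intro j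
      induction j with
      | zero => exact hgt
      | succ j ih => exact ih.trans (hstep _ ih)
    exact not_forall_lt_of_periodic (Γ := Γᵒᵈ) (f := fun j ↦ OrderDual.toDual (v (x j))) hm
      (congrArg v (hper i)) fun j ↦ hstep _ (hall j)

/-- Distinct periodic orbits have distinct reductions. -/
lemma absc_eq_of_val_sub_lt (h2 : v 2 < 1) {m : ℕ} (hm : 0 < m) {u x z : ℕ → C}
    (hu : ∀ i, v (u i) ≤ 1) (hperx : ∀ i, x (i + m) = x i) (hperz : ∀ i, z (i + m) = z i)
    (hx1 : ∀ i, v (x i) = 1) (hz1 : ∀ i, v (z i) = 1)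
    (hx : ∀ i, x (i + 1) * (1 - 4 * (u i * (1 + 4 * u i)) * x i) =
      (1 + 4 * u i) ^ 2 * x i * (x i + 4))
    (hz : ∀ i, z (i + 1) * (1 - 4 * (u i * (1 + 4 * u i)) * z i) =
      (1 + 4 * u i) ^ 2 * z i * (z i + 4)) {i : ℕ} (h : v (x i - z i) < 1) : x i = z i := by
  have h4 := val_four_lt_one h2
  have h41 : ∀ i, v (1 + 4 * u i) = 1 := fun i ↦ val_one_add_mul h4 (hu i)
  have hD : ∀ (y : ℕ → C) i, v (y i) = 1 → v (1 - 4 * (u i * (1 + 4 * u i)) * y i) = 1 := by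
    intro y i hy
    rw [show 1 - 4 * (u i * (1 + 4 * u i)) * y i = 1 + 4 * (-(u i * (1 + 4 * u i)) * y i) by ring]
    refine val_one_add_mul h4 ?_
    rw [map_mul, Valuation.map_neg, map_mul, h41, hy, mul_one, mul_one]
    exact hu i
  have hstep : ∀ j, v (x (j + 1) - z (j + 1)) = v (x j - z j) *
      v ((x j - z j) + 2 * z j + 4 * (1 - u j * (1 + 4 * u j) * x j * z j)) := by
    intro j
    have h1 : (x (j + 1) - z (j + 1)) * (1 - 4 * (u j * (1 + 4 * u j)) * x j) *
        (1 - 4 * (u j * (1 + 4 * u j)) * z j) = (1 + 4 * u j) ^ 2 * (x j - z j) *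
        ((x j - z j) + 2 * z j + 4 * (1 - u j * (1 + 4 * u j) * x j * z j)) := by
      linear_combination (1 - 4 * (u j * (1 + 4 * u j)) * z j) * hx j -
        (1 - 4 * (u j * (1 + 4 * u j)) * x j) * hz j
    have h3 := congrArg v h1
    rwa [map_mul, map_mul, hD x j (hx1 j), hD z j (hz1 j), mul_one, mul_one, map_mul, map_mul,
      map_pow, h41, one_pow, one_mul] at h3
  have hfac : ∀ j, v (x j - z j) < 1 →
      v ((x j - z j) + 2 * z j + 4 * (1 - u j * (1 + 4 * u j) * x j * z j)) < 1 := by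
    intro j hj
    refine v.map_add_lt (v.map_add_lt hj ?_) ?_
    · rw [map_mul, hz1, mul_one]; exact h2
    · rw [map_mul]
      refine mul_lt_one_of_lt_of_le h4 (v.map_sub_le (by rw [map_one]) ?_)
      rw [map_mul, map_mul, map_mul, h41, hx1, hz1, mul_one, mul_one, mul_one]
      exact hu j
  by_contra hne
  have hall : ∀ j, x (i + j) - z (i + j) = 0 ∨ v (x (i + j) - z (i + j)) < 1 := by
    intro j
    right
    induction j with
    | zero => exact h
    | succ j ih =>
      rw [← add_assoc, hstep]
      exact mul_lt_one_of_lt_of_le ih (hfac _ ih).le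
  have hle : ∀ j, v (x (i + j + 1) - z (i + j + 1)) < v (x i - z i) := by
    have hlt : ∀ j, v (x (i + j) - z (i + j)) < 1 := fun j ↦ by
      rcases hall j with h | h
      · rw [h, map_zero]; exact zero_lt_one
      · exact h
    intro j
    induction j with
    | zero =>
      rw [add_zero, hstep]
      exact mul_lt_of_lt_one_right
        (zero_lt_iff.mpr ((Valuation.ne_zero_iff _).mpr (sub_ne_zero.mpr hne))) (hfac _ h)
    | succ j ih =>
      rw [hstep]
      exact (mul_le_of_le_one_right' (hfac _ (hlt (j + 1))).le).trans_lt ih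
  obtain ⟨n, rfl⟩ := Nat.exists_eq_succ_of_ne_zero hm.ne'
  have h9 := hle n
  rw [add_assoc, ← Nat.succ_eq_add_one, hperx, hperz] at h9
  exact h9.false

/-- Points with integral abscissa have integral ordinate on the model `Y² + xY = …`. -/
lemma val_ordi_le_one (h20 : (2 : C) ≠ 0) (h2 : v 2 < 1) {u x W : C} (hu : v u ≤ 1) (hx : v x ≤ 1)
    (hW : W ^ 2 = x * (x + 4) * (1 - 4 * (u * (1 + 4 * u)) * x)) : v ((W - x) / 2) ≤ 1 := by
  have h4 := val_four_lt_one h2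
  set Y := (W - x) / 2 with hY
  have hWY : W = x + 2 * Y := by rw [hY]; field_simp; ring
  have hmem : ∀ a : C, a ∈ v.integer ↔ v a ≤ 1 := fun a ↦ Iff.rfl
  have hr : Y * (Y + x) = x - u * (1 + 4 * u) * x ^ 3 - 4 * (u * (1 + 4 * u)) * x ^ 2 := by
    rw [hWY] at hW
    have h40 : (4 : C) ≠ 0 := by
      rw [show (4 : C) = 2 ^ 2 by norm_num]; exact pow_ne_zero 2 h20
    refine mul_left_cancel₀ h40 ?_
    linear_combination hW
  have h4' : (4 : C) ∈ v.integer := h4.le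
  have hu' : u ∈ v.integer := hu
  have hx' : x ∈ v.integer := hx
  have hv' : u * (1 + 4 * u) ∈ v.integer :=
    mul_mem hu' (add_mem (one_mem _) (mul_mem h4' hu'))
  have hle : v (Y * (Y + x)) ≤ 1 := by
    rw [hr, ← hmem]
    exact sub_mem (sub_mem hx' (mul_mem hv' (pow_mem hx' 3)))
      (mul_mem (mul_mem h4' hv') (pow_mem hx' 2))
  by_contra! hgt
  rw [map_mul, v.map_add_eq_of_lt_left (hx.trans_lt hgt)] at hle
  exact absurd (one_lt_mul'' hgt hgt) (not_lt.mpr hle)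

end Valuation

/-- The reduction of a cycle of Landen transformations is a cycle of Frobenius maps. -/
lemma reduction_frobenius {R K : Type*} [CommRing R] [IsDomain R] (h20 : (2 : R) ≠ 0) [Field K]
    [CharP K 2] (ρ : R →+* K) {U X Y U' X' Y' : R}
    (hU : U ^ 2 = -U' * (1 + 4 * U') * (1 + 4 * U) ^ 2)
    (hX : X' * (1 - 4 * (U * (1 + 4 * U)) * X) = (1 + 4 * U) ^ 2 * X * (X + 4))
    (hY : (X' + 2 * Y') * (1 - 4 * (U * (1 + 4 * U)) * X) ^ 2 =
      (1 + 4 * U) * (X + 2 * Y) * (2 + (1 + 4 * U) * X) * (1 - 2 * U * X))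
    (hXY : (X + 2 * Y) ^ 2 = X * (X + 4) * (1 - 4 * (U * (1 + 4 * U)) * X)) :
    ρ U' = ρ U ^ 2 ∧ ρ X' = ρ X ^ 2 ∧ ρ Y' = ρ Y ^ 2 ∧
      ρ Y ^ 2 + ρ X * ρ Y = ρ X + ρ U * ρ X ^ 3 := by
  have hK2 : (2 : K) = 0 := CharTwo.two_eq_zero
  have hρ2 : ρ 2 = 0 := by rw [map_ofNat]; exact hK2
  have hρ4 : ρ 4 = 0 := by rw [show (4 : R) = 2 * 2 by norm_num, map_mul, hρ2, zero_mul]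
  have h40 : (4 : R) ≠ 0 := by rw [show (4 : R) = 2 * 2 by norm_num]; exact mul_ne_zero h20 h20
  have hr : Y ^ 2 + X * Y = X - U * X ^ 3 - 4 * (U ^ 2 * X ^ 3 + (U * (1 + 4 * U)) * X ^ 2) := by
    refine mul_left_cancel₀ h40 ?_
    linear_combination hXY
  have hr' : ρ Y ^ 2 + ρ X * ρ Y = ρ X + ρ U * ρ X ^ 3 := by
    have := congrArg ρ hr
    simp only [map_add, map_sub, map_mul, map_pow, hρ4, zero_mul, sub_zero] at this
    rw [this, CharTwo.sub_eq_add]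
  refine ⟨?_, ?_, ?_, hr'⟩
  · have := congrArg ρ hU
    simp only [map_add, map_neg, map_mul, map_pow, map_one, hρ4, zero_mul, add_zero, one_pow,
      mul_one] at this
    rw [this, CharTwo.neg_eq]
  · have := congrArg ρ hX
    simp only [map_add, map_sub, map_mul, map_pow, map_one, hρ4, zero_mul, add_zero, one_pow,
      mul_one, sub_zero, one_mul] at this
    rw [this, sq]
  · set c := 1 + 4 * U with hc
    have hY2 : Y' * (1 - 4 * (U * c) * X) ^ 2 = X + X * Y - U * X ^ 3 +
        2 * (Y - U * X ^ 2 - 2 * U ^ 2 * X ^ 3 - c * U * X ^ 2 * Y - c * X + c * (U * c) * X ^ 3 +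
          4 * c * (U * c) * X ^ 2 + 2 * U * (X + 2 * Y + c * X * Y - 2 * U * X ^ 2 -
          c * U * X ^ 3 - 4 * U * X * Y - 2 * c * U * X ^ 2 * Y - 2 * c * X +
          2 * c * (U * c) * X ^ 3 + 8 * c * (U * c) * X ^ 2)) := by
      refine mul_left_cancel₀ h20 ?_
      rw [hc] at *
      linear_combination hY - (1 - 4 * (U * (1 + 4 * U)) * X) * hX
    have := congrArg ρ hY2
    simp only [hc, map_add, map_sub, map_mul, map_pow, map_one, hρ4, hρ2, zero_mul, add_zero,
      one_pow, mul_one, sub_zero] at this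
    rw [this, eq_sub_of_add_eq hr', CharTwo.sub_eq_add, CharTwo.sub_eq_add]
    ring

section FiniteField

variable {m : ℕ} {K : Type*} [Field K]

lemma exists_map_eq_of_pow_eq (hm : m ≠ 0) (ι : GaloisField 2 m →+* K) {x : K}
    (hx : x ^ 2 ^ m = x) : ∃ X, ι X = x := by
  classical
  have : Fintype (GaloisField 2 m) := Fintype.ofFinite _
  have hcard : Fintype.card (GaloisField 2 m) = 2 ^ m := by
    rw [← Nat.card_eq_fintype_card, GaloisField.card 2 m hm]
  have h := (Polynomial.splits_X_pow_nat_card_sub_X (K := GaloisField 2 m)).roots_map ι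
  rw [Nat.card_eq_fintype_card, FiniteField.roots_X_pow_card_sub_X, hcard] at h
  have hmem : x ∈ ((Polynomial.X ^ 2 ^ m - Polynomial.X : Polynomial (GaloisField 2 m)).map
      ι).roots := by
    rw [Polynomial.map_sub, Polynomial.map_pow, Polynomial.map_X, Polynomial.mem_roots
      (FiniteField.X_pow_card_sub_X_ne_zero K (Nat.one_lt_two_pow hm))]
    simp [hx]
  rw [h, Multiset.mem_map] at hmem
  exact hmem.imp fun X h ↦ h.2

lemma sum_artinSchreier [CharP K 2] (y : K) (n : ℕ) :
    ∑ i ∈ Finset.range n, (y ^ 2 + y) ^ 2 ^ i = y ^ 2 ^ n + y := by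
  induction n with
  | zero => simp [CharTwo.add_self_eq_zero]
  | succ n ih =>
    rw [Finset.sum_range_succ, ih, add_pow_char_pow, ← pow_mul, ← pow_succ']
    linear_combination CharTwo.add_self_eq_zero (y ^ 2 ^ n)

lemma map_trace_eq [CharP K 2] (hm : m ≠ 0) (ι : GaloisField 2 m →+* K) {w : GaloisField 2 m} {y : K}
    (h : ι w = y ^ 2 + y) :
    ι (algebraMap (ZMod 2) _ (Algebra.trace (ZMod 2) (GaloisField 2 m) w)) = y ^ 2 ^ m + y := by
  rw [FiniteField.algebraMap_trace_eq_sum_pow, GaloisField.finrank 2 hm, Nat.card_zmod, map_sum,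
    ← sum_artinSchreier]
  simp_rw [map_pow, h]

/-- Points of `Y² + xY = x + Ux³` with Frobenius acting as `±1`, in terms of traces. -/
lemma exists_trace_of_points [CharP K 2] (hm : m ≠ 0) (ι : GaloisField 2 m →+* K) {U : K}
    (hU0 : U ≠ 0) (hU : U ^ 2 ^ m = U) :
    ∃ lam : GaloisField 2 m, lam ≠ 0 ∧ ∀ (x Y : K) (ε : ZMod 2), x ≠ 0 → x ^ 2 ^ m = x →
      Y ^ 2 + x * Y = x + U * x ^ 3 → Y ^ 2 ^ m = Y + ι (algebraMap (ZMod 2) _ ε) * x →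
      ∃ X, X ≠ 0 ∧ ι X = ι lam * x ∧
        Algebra.trace (ZMod 2) (GaloisField 2 m) (lam * (X + X⁻¹)) = ε := by
  obtain ⟨l, hl⟩ := exists_map_eq_of_pow_eq hm ι (x := U ^ 2 ^ (m - 1)) (by
    rw [← pow_mul, mul_comm, pow_mul, hU])
  have hl2 : ι l ^ 2 = U := by
    rw [hl, ← pow_mul, ← pow_succ, Nat.sub_add_cancel (Nat.pos_of_ne_zero hm), hU]
  have hl0 : l ≠ 0 := by
    rintro rfl
    simp [hU0.symm] at hl2
  have hιl : ι l ≠ 0 := (map_ne_zero ι).mpr hl0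
  refine ⟨l, hl0, fun x Y ε hx0 hxq hY hYq ↦ ?_⟩
  obtain ⟨X, rfl⟩ := exists_map_eq_of_pow_eq hm ι hxq
  have hX0 : X ≠ 0 := by rintro rfl; simp at hx0
  refine ⟨l * X, mul_ne_zero hl0 hX0, by simp, ?_⟩
  have hw : ι (l * (l * X + (l * X)⁻¹)) = (Y / ι X) ^ 2 + Y / ι X := by
    rw [map_mul, map_add, map_inv₀, map_mul]
    field_simp
    rw [hl2]
    linear_combination -hY
  have h := map_trace_eq hm ι hw
  rw [div_pow, hYq, hxq] at h
  have h2 : ι (algebraMap (ZMod 2) _ (Algebra.trace (ZMod 2) (GaloisField 2 m)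
      (l * (l * X + (l * X)⁻¹)))) = ι (algebraMap (ZMod 2) _ ε) := by
    rw [h]
    field_simp
    linear_combination CharTwo.add_self_eq_zero Y
  exact (algebraMap (ZMod 2) (GaloisField 2 m)).injective (ι.injective h2)

lemma card_trace_add_card_trace (hm : m ≠ 0) (f : GaloisField 2 m → ZMod 2) :
    Set.ncard {X | X ≠ 0 ∧ f X = 0} + Set.ncard {X | X ≠ 0 ∧ f X = 1} + 1 = 2 ^ m := by
  classical
  have h1 : {X | X ≠ 0 ∧ f X = 0} ∪ {X | X ≠ 0 ∧ f X = 1} = ({0} : Set (GaloisField 2 m))ᶜ := by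
    ext X
    have : ∀ a : ZMod 2, a = 0 ∨ a = 1 := by decide
    have := this (f X)
    simp only [Set.mem_union, Set.mem_ofPred_eq, Set.mem_compl_iff, Set.mem_singleton_iff]
    tauto
  rw [← Set.ncard_union_eq, h1, ← Set.ncard_singleton (0 : GaloisField 2 m), add_comm,
    Set.ncard_add_ncard_compl, GaloisField.card 2 m hm]
  rw [Set.disjoint_left]
  rintro X ⟨-, hX⟩ ⟨-, hX'⟩
  rw [hX] at hX'
  exact zero_ne_one hX'

/-- The nontrivial points of trace zero come in pairs `X`, `X⁻¹`. -/
lemma odd_card_trace_eq_zero (lam : GaloisField 2 m) :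
    Odd (Set.ncard {X | X ≠ 0 ∧
      Algebra.trace (ZMod 2) (GaloisField 2 m) (lam * (X + X⁻¹)) = 0}) := by
  classical
  have : Fintype (GaloisField 2 m) := Fintype.ofFinite _
  set S : Finset (GaloisField 2 m) := {X | X ≠ 0 ∧
      Algebra.trace (ZMod 2) (GaloisField 2 m) (lam * (X + X⁻¹)) = 0} with hS
  have h1 : {X | X ≠ 0 ∧ Algebra.trace (ZMod 2) (GaloisField 2 m) (lam * (X + X⁻¹)) = 0} = (S : Set _) := by
    ext; simp [hS]
  rw [h1, Set.ncard_coe_finset]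
  have hmem : (1 : GaloisField 2 m) ∈ S := by simp [hS, CharTwo.add_self_eq_zero]
  have hev : Even (S.erase 1).card := by
    have h0 : ∑ X ∈ S.erase 1, (1 : ZMod 2) = 0 := by
      refine Finset.sum_involution (fun X _ ↦ X⁻¹) ?_ ?_ ?_ ?_
      · intros; decide
      · simp only [hS, Finset.mem_erase, Finset.mem_filter_univ]
        rintro X ⟨hX1, hX0, -⟩ - h
        have h1 : (X + 1) ^ 2 = 0 := by
          have h2 : 1 = X * X := by nth_rw 2 [← h]; exact (mul_inv_cancel₀ hX0).symm
          linear_combination (X + 1) * CharTwo.add_self_eq_zero (1 : GaloisField 2 m) - h2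
        exact hX1 (CharTwo.add_eq_zero.mp (pow_eq_zero_iff two_ne_zero |>.mp h1))
      · simp only [hS, Finset.mem_erase, Finset.mem_filter_univ]
        rintro X ⟨hX1, hX0, h⟩
        exact ⟨by simpa using hX1, by simpa using hX0, by rwa [inv_inv, add_comm X⁻¹]⟩
      · simp
    rwa [Finset.sum_const, nsmul_one, ZMod.natCast_eq_zero_iff_even] at h0
  rw [← Finset.card_erase_add_one hmem]
  exact hev.add_one

/-- `S` consists of abscissae of points on which the `2^m`-Frobenius acts as the sign `(-1)^ε`. -/
def FrobeniusPoints (ι : GaloisField 2 m →+* K) (U : K) (ε : ZMod 2) (S : Set K) : Prop :=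
  ∀ x ∈ S, x ≠ 0 ∧ x ^ 2 ^ m = x ∧ ∃ Y, Y ^ 2 + x * Y = x + U * x ^ 3 ∧
    Y ^ 2 ^ m = Y + ι (algebraMap (ZMod 2) _ ε) * x

/-- Sufficiently many points on a curve and its twist determine the number of points. -/
lemma exists_card_trace [CharP K 2] (hm : 2 ≤ m) (ι : GaloisField 2 m →+* K) {U : K}
    (hU0 : U ≠ 0) (hU : U ^ 2 ^ m = U) {t : ℤ} (ht : t % 4 = 1) {ε : ZMod 2} {S T : Set K}
    (hS : FrobeniusPoints ι U ε S) (hT : FrobeniusPoints ι U (ε + 1) T)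
    (hSc : 2 * (S.ncard : ℤ) = 2 ^ m - 1 - t) (hTc : 2 * (T.ncard : ℤ) = 2 ^ m - 1 + t) :
    ∃ lam : GaloisField 2 m, lam ≠ 0 ∧
      2 * (Set.ncard {X | X ≠ 0 ∧
        Algebra.trace (ZMod 2) (GaloisField 2 m) (lam * (X + X⁻¹)) = 0} : ℤ) = 2 ^ m - 1 - t ∧
      2 * (Set.ncard {X | X ≠ 0 ∧
        Algebra.trace (ZMod 2) (GaloisField 2 m) (lam * (X + X⁻¹)) = 1} : ℤ) = 2 ^ m - 1 + t := by
  obtain ⟨lam, hlam, h⟩ := exists_trace_of_points (by omega) ι hU0 hU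
  refine ⟨lam, hlam, ?_⟩
  have key : ∀ (S : Set K) (ε : ZMod 2), FrobeniusPoints ι U ε S → S.ncard ≤ Set.ncard {X | X ≠ 0 ∧
      Algebra.trace (ZMod 2) (GaloisField 2 m) (lam * (X + X⁻¹)) = ε} := by
    intro S ε hS
    have h1 : ∀ x ∈ S, ∃ X, X ≠ 0 ∧ ι X = ι lam * x ∧
        Algebra.trace (ZMod 2) (GaloisField 2 m) (lam * (X + X⁻¹)) = ε := by
      intro x hx
      obtain ⟨h0, hq, Y, hY, hYq⟩ := hS x hx
      exact h x Y ε h0 hq hY hYq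
    choose! g hg0 hg hgt using h1
    refine Set.ncard_le_ncard_of_injOn g (fun x hx ↦ ⟨hg0 x hx, hgt x hx⟩) ?_ (Set.toFinite _)
    intro x hx y hy hxy
    have := hg x hx
    rw [hxy, hg y hy] at this
    exact (mul_left_cancel₀ ((map_ne_zero ι).mpr hlam) this).symm
  have hSle := key S ε hS
  have hTle := key T (ε + 1) hT
  have hsum := card_trace_add_card_trace (m := m) (by omega)
    (fun X ↦ Algebra.trace (ZMod 2) (GaloisField 2 m) (lam * (X + X⁻¹)))
  have hodd := odd_card_trace_eq_zero lam
  have h4 : (2 : ℤ) ^ m % 4 = 0 := Int.emod_eq_zero_of_dvd (pow_dvd_pow 2 hm)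
  beta_reduce at hsum
  have hsum' := congrArg (fun n : ℕ ↦ (n : ℤ)) hsum
  push_cast at hsum'
  rw [Nat.odd_iff] at hodd
  have h01 : ∀ a : ZMod 2, a = 0 ∨ a = 1 := by decide
  rcases h01 ε with rfl | rfl
  · rw [zero_add] at hTle
    omega
  · rw [show (1 : ZMod 2) + 1 = 0 by decide] at hTle
    omega

end FiniteField

/-- A cycle of parameters related by Landen transformations. -/
structure LandenCycle (m : ℕ) (u : ℕ → ℂ) : Prop where
  ne_zero (i : ℕ) : u i ≠ 0
  one_add_ne_zero (i : ℕ) : 1 + 8 * u i ≠ 0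
  step (i : ℕ) : u i ^ 2 = -u (i + 1) * (1 + 4 * u (i + 1)) * (1 + 4 * u i) ^ 2
  period : u m = u 0

/-- A point on the curves of a Landen cycle which returns, up to the sign `s`, to itself. -/
structure LandenPoint (m : ℕ) (u : ℕ → ℂ) (s : ℂ) (x W : ℕ → ℂ) : Prop where
  ne_zero (i : ℕ) (hi : i ≤ m) : x i ≠ 0
  step (i : ℕ) (hi : i < m) : x (i + 1) * (1 - 4 * (u i * (1 + 4 * u i)) * x i) =
    (1 + 4 * u i) ^ 2 * x i * (x i + 4)
  period : x m = x 0
  sq (i : ℕ) (hi : i ≤ m) : W i ^ 2 = x i * (x i + 4) * (1 - 4 * (u i * (1 + 4 * u i)) * x i)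
  ordinate_step (i : ℕ) (hi : i < m) :
    W (i + 1) * (1 - 4 * (u i * (1 + 4 * u i)) * x i) ^ 2 =
      (1 + 4 * u i) * W i * (2 + (1 + 4 * u i) * x i) * (1 - 2 * u i * x i)
  ordinate_period : W m = s * W 0

lemma apply_succ_mod {α : Type*} {f : ℕ → α} {m : ℕ} (hm : 0 < m) (hf : f m = f 0) (i : ℕ) :
    f ((i + 1) % m) = f (i % m + 1) := by
  rw [Nat.add_mod]
  rcases Nat.lt_or_ge (i % m + 1) m with h | h
  · have h1 : 1 < m := by omega
    rw [Nat.mod_eq_of_lt h1, Nat.mod_eq_of_lt h]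
  · have h1 : i % m + 1 = m := le_antisymm (Nat.mod_lt i hm) h
    rw [h1, hf]
    rcases Nat.lt_or_ge 1 m with h2 | h2
    · rw [Nat.mod_eq_of_lt h2, h1, Nat.mod_self]
    · obtain rfl : m = 1 := by omega
      simp [Nat.mod_one]

section Landen

variable {Γ : Type*} [LinearOrderedCommGroupWithZero Γ] {v : Valuation ℂ Γ} {m : ℕ} {u : ℕ → ℂ}

lemma LandenCycle.val_mod_eq_one (hu : LandenCycle m u) (hm : 0 < m) (h2 : v 2 < 1)
    (hprod : v (∏ i ∈ Finset.range m, (1 + 4 * u i)) = 1) (i : ℕ) : v (u (i % m)) = 1 := by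
  refine val_modular_cycle v two_ne_zero h2 hm (u := fun i ↦ u (i % m)) (fun i ↦ by simp)
    (fun i ↦ hu.ne_zero _) (fun i ↦ hu.one_add_ne_zero _) (fun i ↦ ?_) ?_ i
  · rw [apply_succ_mod hm hu.period]
    exact hu.step _
  · rw [← hprod]
    congr 1
    refine Finset.prod_congr rfl fun i hi ↦ ?_
    rw [Nat.mod_eq_of_lt (Finset.mem_range.mp hi)]

lemma val_eq_one_of_mod {f : ℕ → ℂ} (hf : f m = f 0) (h : ∀ i, v (f (i % m)) = 1) {i : ℕ}
    (hi : i ≤ m) : v (f i) = 1 := by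
  rcases hi.eq_or_lt with rfl | hi
  · rw [hf, ← Nat.zero_mod i]
    exact h 0
  · rw [← Nat.mod_eq_of_lt hi]
    exact h i

lemma LandenPoint.step_mod {s : ℂ} {x W : ℕ → ℂ} (hx : LandenPoint m u s x W) (hm : 0 < m)
    (i : ℕ) :
    x ((i + 1) % m) * (1 - 4 * (u (i % m) * (1 + 4 * u (i % m))) * x (i % m)) =
      (1 + 4 * u (i % m)) ^ 2 * x (i % m) * (x (i % m) + 4) := by
  rw [apply_succ_mod hm hx.period]
  exact hx.step _ (Nat.mod_lt _ hm)

lemma LandenPoint.val_mod_eq_one {s : ℂ} {x W : ℕ → ℂ} (hx : LandenPoint m u s x W) (hm : 0 < m)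
    (h2 : v 2 < 1) (hu : ∀ i, v (u (i % m)) = 1) (i : ℕ) : v (x (i % m)) = 1 :=
  val_absc_cycle v h2 hm (u := fun i ↦ u (i % m)) (x := fun i ↦ x (i % m)) (fun i ↦ (hu i).le)
    (fun i ↦ by simp) (fun i ↦ hx.ne_zero _ (Nat.mod_lt _ hm).le) (hx.step_mod hm) i

lemma LandenPoint.eq_of_val_sub_lt {s : ℂ} {x W z W' : ℕ → ℂ} (hx : LandenPoint m u s x W)
    (hz : LandenPoint m u s z W') (hm : 0 < m) (h2 : v 2 < 1) (hu : ∀ i, v (u (i % m)) = 1)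
    (h : v (x 0 - z 0) < 1) : x 0 = z 0 := by
  have := absc_eq_of_val_sub_lt v h2 hm (u := fun i ↦ u (i % m)) (x := fun i ↦ x (i % m))
    (z := fun i ↦ z (i % m)) (fun i ↦ (hu i).le) (fun i ↦ by simp) (fun i ↦ by simp)
    (hx.val_mod_eq_one hm h2 hu) (hz.val_mod_eq_one hm h2 hu) (hx.step_mod hm) (hz.step_mod hm)
    (i := 0)
  simp only [Nat.zero_mod] at this
  exact this h

section Reduction

variable {V : ValuationSubring ℂ} {K : Type*} [Field K] [CharP K 2] (ρ : V →+* K)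

lemma LandenCycle.map_pow_eq (hu : LandenCycle m u) (hV : ∀ i ≤ m, u i ∈ V) :
    ∀ i (hi : i ≤ m), ρ ⟨u i, hV i hi⟩ = ρ ⟨u 0, hV 0 (Nat.zero_le _)⟩ ^ 2 ^ i := by
  have hK2 : (2 : K) = 0 := CharTwo.two_eq_zero
  intro i
  induction i with
  | zero => simp
  | succ i ih =>
    intro hi
    rw [pow_succ, pow_mul, ← ih (by omega)]
    have h : (⟨u i, hV i (by omega)⟩ : V) ^ 2 = -⟨u (i + 1), hV _ hi⟩ *
        (1 + 4 * ⟨u (i + 1), hV _ hi⟩) * (1 + 4 * ⟨u i, hV i (by omega)⟩) ^ 2 :=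
      Subtype.ext (hu.step i)
    have h4 : ρ 4 = 0 := by
      rw [map_ofNat, show (4 : K) = 2 * 2 by norm_num, hK2, zero_mul]
    have := congrArg ρ h
    simp only [map_add, map_neg, map_mul, map_pow, map_one, h4, zero_mul, add_zero, one_pow,
      mul_one] at this
    rw [this, CharTwo.neg_eq]

lemma LandenPoint.map_pow_eq (hu : LandenCycle m u) {s : ℂ} {x W : ℕ → ℂ}
    (hx : LandenPoint m u s x W) (hm : 0 < m) (hV : ∀ i ≤ m, u i ∈ V) (hxV : ∀ i ≤ m, x i ∈ V)
    (hYV : ∀ i ≤ m, (W i - x i) / 2 ∈ V) :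
    (∀ i (hi : i ≤ m), ρ ⟨x i, hxV i hi⟩ = ρ ⟨x 0, hxV 0 (Nat.zero_le _)⟩ ^ 2 ^ i ∧
      ρ ⟨_, hYV i hi⟩ = ρ ⟨_, hYV 0 (Nat.zero_le _)⟩ ^ 2 ^ i) ∧
    ρ ⟨_, hYV 0 (Nat.zero_le _)⟩ ^ 2 + ρ ⟨_, hxV 0 (Nat.zero_le _)⟩ * ρ ⟨_, hYV 0 (Nat.zero_le _)⟩ =
      ρ ⟨_, hxV 0 (Nat.zero_le _)⟩ + ρ ⟨_, hV 0 (Nat.zero_le _)⟩ *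
        ρ ⟨_, hxV 0 (Nat.zero_le _)⟩ ^ 3 := by
  have key : ∀ i (hi : i + 1 ≤ m), ρ ⟨_, hV _ hi⟩ = ρ ⟨_, hV i (by omega)⟩ ^ 2 ∧
      ρ ⟨_, hxV _ hi⟩ = ρ ⟨_, hxV i (by omega)⟩ ^ 2 ∧
      ρ ⟨_, hYV _ hi⟩ = ρ ⟨_, hYV i (by omega)⟩ ^ 2 ∧
      ρ ⟨_, hYV i (by omega)⟩ ^ 2 + ρ ⟨_, hxV i (by omega)⟩ * ρ ⟨_, hYV i (by omega)⟩ =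
      ρ ⟨_, hxV i (by omega)⟩ + ρ ⟨_, hV i (by omega)⟩ * ρ ⟨_, hxV i (by omega)⟩ ^ 3 := by
    intro i hi
    refine reduction_frobenius (fun h ↦ two_ne_zero (congrArg Subtype.val h)) ρ
      (Subtype.ext (hu.step i)) (Subtype.ext (hx.step i hi)) (Subtype.ext ?_) (Subtype.ext ?_)
    · change (x (i + 1) + 2 * ((W (i + 1) - x (i + 1)) / 2)) * (1 - 4 * (u i * (1 + 4 * u i)) * x i) ^ 2 =
        (1 + 4 * u i) * (x i + 2 * ((W i - x i) / 2)) * (2 + (1 + 4 * u i) * x i) *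
          (1 - 2 * u i * x i)
      linear_combination hx.ordinate_step i hi
    · change (x i + 2 * ((W i - x i) / 2)) ^ 2 = x i * (x i + 4) * (1 - 4 * (u i * (1 + 4 * u i)) * x i)
      linear_combination hx.sq i (by omega)
  refine ⟨fun i ↦ ?_, (key 0 hm).2.2.2⟩
  induction i with
  | zero => simp
  | succ i ih =>
    intro hi
    obtain ⟨h1, h2⟩ := ih (by omega)
    rw [pow_succ, pow_mul, pow_mul, ← h1, ← h2]
    exact ⟨(key i hi).2.1, (key i hi).2.2.1⟩

/-- The points of a Landen cycle reduce to points whose Frobenius is a sign. -/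
lemma exists_frobeniusPoints (hρ : ∀ a : V, ρ a = 0 ↔ V.valuation a < 1) (hm : 0 < m)
    (hu : LandenCycle m u) (h2 : V.valuation 2 < 1)
    (hprod : V.valuation (∏ i ∈ Finset.range m, (1 + 4 * u i)) = 1)
    (ι : GaloisField 2 m →+* K) :
    ∃ U : K, U ≠ 0 ∧ U ^ 2 ^ m = U ∧ ∀ (s : ℤ) (ε : ZMod 2), (s = 1 ∧ ε = 0 ∨ s = -1 ∧ ε = 1) →
      ∀ (J : Finset ℕ) (x W : ℕ → ℕ → ℂ), (∀ j ∈ J, LandenPoint m u s (x j) (W j)) →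
      (∀ j ∈ J, ∀ k ∈ J, x j 0 = x k 0 → j = k) →
      ∃ S : Set K, FrobeniusPoints ι U ε S ∧ S.ncard = J.card := by
  have hu1 := hu.val_mod_eq_one hm h2 hprod
  have huV : ∀ i ≤ m, V.valuation (u i) = 1 := fun i ↦ val_eq_one_of_mod hu.period hu1
  have hV : ∀ i ≤ m, u i ∈ V := fun i hi ↦ V.mem_of_valuation_le_one _ (huV i hi).le
  have hne : ∀ a : V, V.valuation a = 1 → ρ a ≠ 0 := fun a ha h ↦ ((hρ a).mp h).ne ha
  refine ⟨ρ ⟨u 0, hV 0 (Nat.zero_le _)⟩, hne _ (huV 0 (Nat.zero_le _)), ?_, ?_⟩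
  · rw [← hu.map_pow_eq ρ hV m le_rfl]
    congr 2
    exact hu.period
  intro s ε hs J x W hp hinj
  have hx1 : ∀ j ∈ J, ∀ i ≤ m, V.valuation (x j i) = 1 := fun j hj i ↦
    val_eq_one_of_mod (hp j hj).period ((hp j hj).val_mod_eq_one hm h2 hu1)
  have hxV : ∀ j ∈ J, ∀ i ≤ m, x j i ∈ V := fun j hj i hi ↦
    V.mem_of_valuation_le_one _ (hx1 j hj i hi).le
  have hYV : ∀ j ∈ J, ∀ i ≤ m, (W j i - x j i) / 2 ∈ V := fun j hj i hi ↦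
    V.mem_of_valuation_le_one _ (val_ordi_le_one _ two_ne_zero h2 (huV i hi).le
      (hx1 j hj i hi).le ((hp j hj).sq i hi))
  refine ⟨Set.range fun j : J ↦ ρ ⟨x j 0, hxV j j.2 0 (Nat.zero_le _)⟩, ?_, ?_⟩
  · rintro _ ⟨⟨j, hj⟩, rfl⟩
    obtain ⟨h1, h3⟩ := (hp j hj).map_pow_eq ρ hu hm hV (hxV j hj) (hYV j hj)
    obtain ⟨h4, h5⟩ := h1 m le_rfl
    refine ⟨hne _ (hx1 j hj 0 (Nat.zero_le _)), ?_, _, h3, ?_⟩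
    · dsimp only
      rw [← h4]
      congr 2
      exact (hp j hj).period
    · rw [← h5]
      have hW := (hp j hj).ordinate_period
      rcases hs with ⟨rfl, rfl⟩ | ⟨rfl, rfl⟩
      · rw [map_zero, map_zero, zero_mul, add_zero]
        congr 2
        rw [hW, (hp j hj).period, Int.cast_one, one_mul]
      · rw [map_one, map_one, one_mul, ← map_add, ← CharTwo.neg_eq (ρ (_ + _)),
          ← map_neg]
        congr 1
        refine Subtype.ext ?_
        change (W j m - x j m) / 2 = -((W j 0 - x j 0) / 2 + x j 0)
        rw [hW, (hp j hj).period, Int.cast_neg, Int.cast_one]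
        ring
  · rw [← Set.image_univ, Set.ncard_image_of_injective, Set.ncard_univ, Nat.card_eq_fintype_card,
      Fintype.card_coe]
    rintro ⟨j, hj⟩ ⟨k, hk⟩ hjk
    refine Subtype.ext (hinj j hj k hk ?_)
    refine (hp j hj).eq_of_val_sub_lt (hp k hk) hm h2 hu1 ?_
    rw [← sub_eq_zero, ← map_sub, hρ] at hjk
    exact hjk

end Reduction

end Landen

namespace PeriodPair

open Filter Topology

variable (L : PeriodPair)

/-- The chain of lattices obtained by halving the first period repeatedly. -/
noncomputable def halfIter (L : PeriodPair) : ℕ → PeriodPair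
  | 0 => L
  | i + 1 => (halfIter L i).half

lemma halfIter_succ (i : ℕ) : L.halfIter (i + 1) = (L.halfIter i).half := rfl

lemma ω₁_halfIter (i : ℕ) : (L.halfIter i).ω₁ = L.ω₁ / 2 ^ i := by
  induction i with
  | zero => simp [halfIter]
  | succ i ih => rw [halfIter_succ, ω₁_half, ih, pow_succ, div_div]

lemma ω₂_halfIter (i : ℕ) : (L.halfIter i).ω₂ = L.ω₂ := by
  induction i with
  | zero => rfl
  | succ i ih => rw [halfIter_succ, ω₂_half, ih]

lemma lattice_halfIter_mono {i j : ℕ} (hij : i ≤ j) {z : ℂ} (hz : z ∈ (L.halfIter i).lattice) :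
    z ∈ (L.halfIter j).lattice := by
  induction j, hij using Nat.le_induction with
  | base => exact hz
  | succ j _ ih => exact ((L.halfIter j).mem_lattice_half z).mpr (Or.inl ih)

lemma landenCycle_halfIter {m : ℕ} (h : (L.halfIter m).modU = L.modU) :
    LandenCycle m fun i ↦ (L.halfIter i).modU where
  ne_zero _ := modU_ne_zero _
  one_add_ne_zero _ := one_add_eight_modU_ne_zero _
  step i := (L.halfIter i).modU_half
  period := h

variable {L} in
lemma weierstrassP_eq_of_sub_mem {z w : ℂ} (h : z - w ∈ L.lattice) :
    L.weierstrassP z = L.weierstrassP w := by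
  have := L.weierstrassP_add_coe w ⟨_, h⟩
  rwa [add_sub_cancel] at this

variable {L} in
lemma derivWeierstrassP_eq_of_sub_mem {z w : ℂ} (h : z - w ∈ L.lattice) :
    L.derivWeierstrassP z = L.derivWeierstrassP w := by
  have := L.derivWeierstrassP_add_coe w ⟨_, h⟩
  rwa [add_sub_cancel] at this

variable {L} in
lemma absc_eq_of_sub_mem {z w : ℂ} (h : z - w ∈ L.lattice) : L.absc z = L.absc w := by
  rw [absc, absc, weierstrassP_eq_of_sub_mem h]

variable {L} in
lemma ordi_eq_of_sub_mem {z w : ℂ} (h : z - w ∈ L.lattice) : L.ordi z = L.ordi w := by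
  rw [ordi, ordi, weierstrassP_eq_of_sub_mem h, derivWeierstrassP_eq_of_sub_mem h]

lemma absc_neg (z : ℂ) : L.absc (-z) = L.absc z := by
  rw [absc, absc, weierstrassP_neg]

lemma ordi_neg (z : ℂ) : L.ordi (-z) = -L.ordi z := by
  rw [ordi, ordi, weierstrassP_neg, derivWeierstrassP_neg]
  ring

variable {L} in
lemma weierstrassP_eq_of_absc_eq {z w : ℂ} (hz : 2 * z ∉ L.lattice) (hw : 2 * w ∉ L.lattice)
    (h : L.absc z = L.absc w) : L.weierstrassP z = L.weierstrassP w := by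
  have h1 := (L.weierstrassP_sub_e_ne_zero hz).2.2
  have h2 := (L.weierstrassP_sub_e_ne_zero hw).2.2
  have h3 := sub_ne_zero.mpr L.e₁_ne_e₃
  rw [absc, absc, div_eq_div_iff h1 h2] at h
  linear_combination (mul_left_cancel₀ (mul_ne_zero (by norm_num) h3) h).symm

/-- Multiplication by `α` maps `L'` to `L` and is compatible with the chosen torsion points. -/
structure IsHomothety (L' L : PeriodPair) (α : ℂ) : Prop where
  ne_zero : α ≠ 0
  mem_iff (z : ℂ) : z ∈ L'.lattice ↔ α * z ∈ L.lattice
  ω₁ : α * (L'.ω₁ / 2) - L.ω₁ / 2 ∈ L.lattice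
  ω₂ : α * (L'.ω₂ / 2) - L.ω₂ / 2 ∈ L.lattice
  quarter : α * (L'.ω₁ / 4) - L.ω₁ / 4 ∈ L.lattice

namespace IsHomothety

variable {L' L : PeriodPair} {α : ℂ} (h : IsHomothety L' L α)
include h

lemma e₁ : L'.e₁ = α ^ 2 * L.e₁ := by
  rw [PeriodPair.e₁, PeriodPair.e₁, weierstrassP_of_mul h.ne_zero h.mem_iff,
    weierstrassP_eq_of_sub_mem h.ω₁]

lemma e₃ : L'.e₃ = α ^ 2 * L.e₃ := by
  rw [PeriodPair.e₃, PeriodPair.e₃, weierstrassP_of_mul h.ne_zero h.mem_iff,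
    weierstrassP_eq_of_sub_mem h.ω₂]

lemma quarterDiff : L'.quarterDiff = α ^ 2 * L.quarterDiff := by
  rw [PeriodPair.quarterDiff, PeriodPair.quarterDiff, weierstrassP_of_mul h.ne_zero h.mem_iff,
    weierstrassP_eq_of_sub_mem h.quarter, h.e₁]
  ring

lemma modU : L'.modU = L.modU := by
  rw [PeriodPair.modU, PeriodPair.modU, h.quarterDiff, h.e₁, h.e₃, ← mul_sub,
    mul_div_mul_left _ _ (pow_ne_zero 2 h.ne_zero)]

lemma absc (z : ℂ) : L'.absc z = L.absc (α * z) := by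
  rw [PeriodPair.absc, PeriodPair.absc, weierstrassP_of_mul h.ne_zero h.mem_iff, h.e₁, h.e₃,
    ← mul_sub, ← mul_sub, mul_left_comm, mul_div_mul_left _ _ (pow_ne_zero 2 h.ne_zero)]

lemma ordi (z : ℂ) : α * L'.ordi z = L.ordi (α * z) := by
  rw [PeriodPair.ordi, PeriodPair.ordi, weierstrassP_of_mul h.ne_zero h.mem_iff,
    derivWeierstrassP_of_mul h.ne_zero h.mem_iff, h.e₃, ← mul_sub, mul_pow, ← pow_mul,
    ← mul_div_assoc, show α * (2 * Complex.I * (α ^ 3 * L.derivWeierstrassP (α * z))) =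
      α ^ (2 * 2) * (2 * Complex.I * L.derivWeierstrassP (α * z)) by ring,
    mul_div_mul_left _ _ (pow_ne_zero _ h.ne_zero)]

end IsHomothety

/-- The scaling factor which makes the equation of the `i`th curve monic. -/
noncomputable def scale (a : ℂ) (i : ℕ) : ℂ :=
  a * ∏ j ∈ Finset.range i, (2 * (1 + 4 * (L.halfIter j).modU))

lemma scale_succ (a : ℂ) (i : ℕ) :
    L.scale a (i + 1) = 2 * (1 + 4 * (L.halfIter i).modU) * L.scale a i := by
  rw [scale, scale, Finset.prod_range_succ]
  ring

lemma scale_sq {a : ℂ} (ha : a ^ 2 = L.e₁ - L.e₃) (i : ℕ) :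
    L.scale a i ^ 2 = (L.halfIter i).e₁ - (L.halfIter i).e₃ := by
  induction i with
  | zero => simpa [scale, halfIter] using ha
  | succ i ih =>
    rw [halfIter_succ, e₁_sub_e₃_half, ← ih, scale_succ]
    ring

lemma landenPoint {m : ℕ} {α a s δ : ℂ} (h : IsHomothety (L.halfIter m) L α)
    (ha : a ^ 2 = L.e₁ - L.e₃) (hs : L.scale a m = s * α * a) (hδ : δ = 1 ∨ δ = -1) {z : ℂ}
    (hz : 2 * z ∉ L.lattice) (hαz : α * z - δ * z ∈ L.lattice) :
    LandenPoint m (fun i ↦ (L.halfIter i).modU) (s * δ) (fun i ↦ (L.halfIter i).absc z)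
      (fun i ↦ L.scale a i * (L.halfIter i).ordi z) := by
  have hz' : ∀ i ≤ m, 2 * z ∉ (L.halfIter i).lattice := by
    intro i hi hmem
    have h1 := (h.mem_iff _).mp (L.lattice_halfIter_mono hi hmem)
    have h2 := L.lattice.sub_mem h1 (L.lattice.add_mem hαz hαz)
    rw [show α * (2 * z) - (α * z - δ * z + (α * z - δ * z)) = δ * (2 * z) by ring] at h2
    rcases hδ with rfl | rfl
    · exact hz (by simpa using h2)
    · exact hz (by simpa using h2)
  have hδz : L.absc (δ * z) = L.absc z ∧ L.ordi (δ * z) = δ * L.ordi z := by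
    rcases hδ with rfl | rfl
    · simp
    · simp [absc_neg, ordi_neg]
  refine ⟨fun i hi ↦ absc_ne_zero _ (hz' i hi), fun i hi ↦ absc_half _ (hz' i hi.le), ?_,
    fun i hi ↦ ?_, fun i hi ↦ ?_, ?_⟩
  · change _ = L.absc z
    rw [h.absc, absc_eq_of_sub_mem hαz, hδz.1]
  · rw [mul_pow, L.scale_sq ha, ordi_sq _ (hz' i hi)]
  · rw [scale_succ, halfIter_succ]
    linear_combination (1 + 4 * (L.halfIter i).modU) * L.scale a i * ordi_half _ (hz' i hi.le)
  · change _ = s * δ * (L.scale a 0 * L.ordi z)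
    rw [hs, mul_right_comm s, mul_assoc, h.ordi, ordi_eq_of_sub_mem hαz, hδz.2]
    simp only [scale, Finset.range_zero, Finset.prod_empty]
    ring

lemma exists_scale_eq {m : ℕ} {α a : ℂ} (h : IsHomothety (L.halfIter m) L α)
    (ha : a ^ 2 = L.e₁ - L.e₃) : ∃ s : ℤ, (s = 1 ∨ s = -1) ∧ L.scale a m = s * α * a := by
  have h1 : L.scale a m ^ 2 = (α * a) ^ 2 := by
    rw [L.scale_sq ha, h.e₁, h.e₃, mul_pow, ha, mul_sub]
  rcases sq_eq_sq_iff_eq_or_eq_neg.mp h1 with h2 | h2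
  · exact ⟨1, Or.inl rfl, by simp [h2]⟩
  · exact ⟨-1, Or.inr rfl, by simp [h2]⟩

lemma prod_modU_sq {m : ℕ} {α : ℂ} (h : IsHomothety (L.halfIter m) L α) :
    (2 ^ m * ∏ i ∈ Finset.range m, (1 + 4 * (L.halfIter i).modU)) ^ 2 = α ^ 2 := by
  obtain ⟨a, ha⟩ := IsAlgClosed.exists_pow_nat_eq (L.e₁ - L.e₃) two_pos
  have h0 := sub_ne_zero.mpr L.e₁_ne_e₃
  have h1 := L.scale_sq ha m
  rw [h.e₁, h.e₃, scale, Finset.prod_mul_distrib, Finset.prod_const, Finset.card_range, mul_pow,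
    ha, ← mul_sub] at h1
  exact mul_left_cancel₀ h0 (by rw [h1, mul_comm])

end PeriodPair

/-- The roots of `X² - tX + 2^m`, assumed not to be real. -/
structure FrobeniusRoots (m : ℕ) (t : ℤ) (α β : ℂ) : Prop where
  add : α + β = t
  mul : α * β = 2 ^ m
  im_ne_zero : α.im ≠ 0

namespace FrobeniusRoots

open Filter Topology

variable {m : ℕ} {t : ℤ} {α β : ℂ} (h : FrobeniusRoots m t α β)

include h in
lemma symm : FrobeniusRoots m t β α where
  add := by rw [add_comm, h.add]
  mul := by rw [mul_comm, h.mul]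
  im_ne_zero := by
    have := congrArg Complex.im h.add
    simp only [Complex.add_im, Complex.intCast_im] at this
    have := h.im_ne_zero
    contrapose! this
    linarith

include h in
lemma eq_of_add_mul_eq {a b c d : ℝ} (hab : (a : ℂ) + b * α = c + d * α) : a = c ∧ b = d := by
  have him := congrArg Complex.im hab
  have hre := congrArg Complex.re hab
  simp at him hre
  rcases him with rfl | him
  · exact ⟨by linarith, rfl⟩
  · exact absurd him h.im_ne_zero

/-- A lattice for the ring `ℤ[α]`, with a convenient basis. -/
noncomputable def periodPair : PeriodPair where
  ω₁ := β - 2 ^ m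
  ω₂ := 1 + (β - 2 ^ m)
  indep := by
    rw [LinearIndependent.pair_iff]
    intro x y hxy
    have him := congrArg Complex.im hxy
    have hre := congrArg Complex.re hxy
    have h2 : ((2 : ℂ) ^ m).im = 0 := by exact_mod_cast Complex.ofReal_im (2 ^ m)
    simp [h2] at him hre
    have := h.symm.im_ne_zero
    have h3 : (x + y) * β.im = 0 := by linarith
    have h4 := (mul_eq_zero.mp h3).resolve_right this
    have h5 : y = 0 := by linear_combination hre - (β.re - ((2 : ℂ) ^ m).re) * h4
    exact ⟨by linarith, h5⟩

lemma ω₁_periodPair : h.periodPair.ω₁ = β - 2 ^ m := rfl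

lemma ω₂_periodPair : h.periodPair.ω₂ = 1 + (β - 2 ^ m) := rfl

lemma mem_periodPair (z : ℂ) : z ∈ h.periodPair.lattice ↔ ∃ a b : ℤ, z = a + b * α := by
  rw [PeriodPair.mem_lattice, ω₁_periodPair, ω₂_periodPair]
  have hβ : β = t - α := by rw [← h.add]; ring
  constructor
  · rintro ⟨a, b, rfl⟩
    refine ⟨a * (t - 2 ^ m) + b * (1 + t - 2 ^ m), -a - b, ?_⟩
    rw [hβ]; push_cast; ring
  · rintro ⟨a, b, rfl⟩
    refine ⟨-b - (a + b * (t - 2 ^ m)), a + b * (t - 2 ^ m), ?_⟩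
    rw [hβ]; push_cast; ring

include h in
lemma ne_zero_left : α ≠ 0 := fun h0 ↦ h.im_ne_zero (by rw [h0, Complex.zero_im])

lemma isHomothety (hm : 2 ≤ m) (ht : t % 4 = 1) :
    PeriodPair.IsHomothety (h.periodPair.halfIter m) h.periodPair α := by
  have hβ : β = t - α := by rw [← h.add]; ring
  have hq : (2 : ℂ) ^ m ≠ 0 := pow_ne_zero _ two_ne_zero
  have hω₁ : α * ((β - 2 ^ m) / 2 ^ m) = 1 - α := by
    field_simp
    linear_combination h.mul
  have hω₂ : α * (1 + (β - 2 ^ m)) = 2 ^ m + (1 - 2 ^ m) * α := by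
    linear_combination h.mul
  obtain ⟨k, rfl⟩ : ∃ k, m = k + 2 := ⟨m - 2, by omega⟩
  obtain ⟨c, hc⟩ : ∃ c : ℤ, t = 4 * c + 1 := ⟨t / 4, by omega⟩
  refine ⟨h.ne_zero_left, fun z ↦ ?_, ?_, ?_, ?_⟩
  · rw [h.mem_periodPair, PeriodPair.mem_lattice, PeriodPair.ω₁_halfIter, PeriodPair.ω₂_halfIter,
      ω₁_periodPair, ω₂_periodPair]
    constructor
    · rintro ⟨a, b, rfl⟩
      refine ⟨a + b * 2 ^ (k + 2), -a + b * (1 - 2 ^ (k + 2)), ?_⟩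
      push_cast
      linear_combination a * hω₁ + b * hω₂
    · rintro ⟨a, b, hab⟩
      refine ⟨a - 2 ^ (k + 2) * (a + b), a + b, mul_left_cancel₀ h.ne_zero_left ?_⟩
      rw [hab]
      push_cast
      linear_combination (a - 2 ^ (k + 2) * (a + b)) * hω₁ + (a + b) * hω₂
  · rw [h.mem_periodPair, PeriodPair.ω₁_halfIter, ω₁_periodPair]
    refine ⟨2 * (2 ^ k - c), 0, ?_⟩
    rw [mul_div_assoc', hω₁, hβ, hc]
    push_cast
    ring
  · rw [h.mem_periodPair, PeriodPair.ω₂_halfIter, ω₂_periodPair]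
    refine ⟨2 ^ (k + 2) - 2 * c - 1, 1 - 2 * 2 ^ k, ?_⟩
    rw [mul_div_assoc', hω₂, hβ, hc]
    push_cast
    ring
  · rw [h.mem_periodPair, PeriodPair.ω₁_halfIter, ω₁_periodPair]
    refine ⟨2 ^ k - c, 0, ?_⟩
    rw [mul_div_assoc', hω₁, hβ, hc]
    push_cast
    ring

include h in
lemma sub_intCast_ne_zero (δ : ℤ) : α - δ ≠ 0 := fun h0 ↦ h.im_ne_zero (by
  have := congrArg Complex.im h0
  simpa using this)

/-- The kernel of `α - δ` on the torus is cyclic, of order `2^m + 1 - δt`. -/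
lemma mul_inv_mem_iff {δ : ℤ} (hδ : δ = 1 ∨ δ = -1) {N : ℕ} (hN : (N : ℤ) = 2 ^ m + 1 - δ * t)
    (j : ℤ) : (j : ℂ) * (α - δ)⁻¹ ∈ h.periodPair.lattice ↔ (N : ℤ) ∣ j := by
  have hβ : β = t - α := by rw [← h.add]; ring
  have hδ2 : (δ : ℂ) ^ 2 = 1 := by rcases hδ with rfl | rfl <;> simp
  have hNc : (N : ℂ) = (α - δ) * (t - δ - α) := by
    have : (N : ℂ) = 2 ^ m + 1 - δ * t := by exact_mod_cast congrArg (fun n : ℤ ↦ (n : ℂ)) hN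
    rw [this, ← h.mul, hβ, ← hδ2]
    ring
  have h0 := h.sub_intCast_ne_zero δ
  have hN0 : (N : ℂ) ≠ 0 := by
    rw [hNc]
    refine mul_ne_zero h0 ?_
    rw [show (t : ℂ) - δ - α = β - δ by rw [hβ]; ring]
    exact h.symm.sub_intCast_ne_zero δ
  rw [h.mem_periodPair]
  constructor
  · rintro ⟨a, b, hab⟩
    have h1 : (j * (t - δ) : ℂ) + (-j : ℂ) * α = N * a + N * b * α := by
      rw [mul_assoc, ← mul_add, ← hab, hNc]
      field_simp
      ring
    obtain ⟨-, h2⟩ := h.eq_of_add_mul_eq (a := j * (t - δ)) (b := -j) (c := N * a) (d := N * b)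
      (by push_cast; exact h1)
    exact ⟨-b, by
      have : -j = N * b := by exact_mod_cast h2
      linarith⟩
  · rintro ⟨b, rfl⟩
    refine ⟨b * (t - δ), -b, ?_⟩
    push_cast
    rw [hNc]
    field_simp
    ring

end FrobeniusRoots

/-- There is a place of `ℂ` above `2`. -/
lemma exists_valuationSubring_two : ∃ V : ValuationSubring ℂ, V.valuation 2 < 1 := by
  let A : Subring ℂ := (Int.castRingHom ℂ).range
  let I : Ideal A := Ideal.span {2}
  have hI : I ≠ ⊤ := by
    intro h
    rw [Ideal.span_singleton_eq_top, isUnit_iff_exists_inv] at h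
    obtain ⟨⟨_, b, rfl⟩, hb⟩ := h
    have h1 : (2 : ℂ) * b = 1 := congrArg Subtype.val hb
    have h2 : (2 : ℤ) * b = 1 := by exact_mod_cast h1
    omega
  obtain ⟨V, -, hV⟩ := Ideal.image_subset_nonunits_valuationSubring I hI
  exact ⟨V, hV ⟨2, Ideal.mem_span_singleton_self _, rfl⟩⟩

lemma ValuationSubring.valuation_intCast_eq_one {V : ValuationSubring ℂ} (h2 : V.valuation 2 < 1)
    {t : ℤ} (ht : Odd t) : V.valuation t = 1 := by
  obtain ⟨k, rfl⟩ := ht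
  have hk : V.valuation (k : ℂ) ≤ 1 := V.valuation_le_one ⟨k, intCast_mem V k⟩
  push_cast
  rw [add_comm]
  exact val_one_add_mul h2 hk

lemma exists_frobeniusRoots {V : ValuationSubring ℂ} (h2 : V.valuation 2 < 1) {m : ℕ} (hm : m ≠ 0)
    {t : ℤ} (ht : Odd t) (htq : t ^ 2 < 4 * 2 ^ m) :
    ∃ α β, FrobeniusRoots m t α β ∧ V.valuation β = 1 := by
  obtain ⟨d, hd⟩ := IsAlgClosed.exists_pow_nat_eq ((t : ℂ) ^ 2 - 4 * 2 ^ m) two_pos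
  have hd0 : d.im ≠ 0 := by
    intro h0
    have hre := congrArg Complex.re hd
    have h1 : ((t : ℂ) ^ 2 - 4 * 2 ^ m) = ((t ^ 2 - 4 * 2 ^ m : ℤ) : ℂ) := by push_cast; rfl
    rw [h1, Complex.intCast_re, sq, Complex.mul_re, h0, mul_zero, sub_zero] at hre
    have h3 : ((t ^ 2 - 4 * 2 ^ m : ℤ) : ℝ) < 0 := by exact_mod_cast sub_neg.mpr htq
    nlinarith [mul_self_nonneg d.re]
  have hroots : FrobeniusRoots m t ((t + d) / 2) ((t - d) / 2) := by
    refine ⟨by ring, by linear_combination -hd / 4, ?_⟩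
    simpa using hd0
  generalize ((t : ℂ) + d) / 2 = α at hroots
  generalize ((t : ℂ) - d) / 2 = β at hroots
  have ht1 := ValuationSubring.valuation_intCast_eq_one h2 ht
  have hmul : V.valuation α * V.valuation β < 1 := by
    rw [← map_mul, hroots.mul, map_pow]
    exact pow_lt_one₀ zero_le h2 hm
  have key : ∀ α β : ℂ, FrobeniusRoots m t α β → V.valuation α < 1 → V.valuation β = 1 := by
    intro α β h hα
    rw [show β = t + -α by rw [← h.add]; ring, Valuation.map_add_eq_of_lt_left, ht1]
    rwa [Valuation.map_neg, ht1]
  by_cases hα : V.valuation α < 1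
  · exact ⟨α, β, hroots, key _ _ hroots hα⟩
  · refine ⟨β, α, hroots.symm, key _ _ hroots.symm ?_⟩
    by_contra! hβ
    exact absurd hmul (not_lt.mpr (one_le_mul (not_lt.mp hα) hβ))

/-- Each `t ≡ 1 mod 4` in the Hasse interval is a trace of Frobenius. -/
lemma exists_card_trace_eq {m : ℕ} (hm : 2 ≤ m) {t : ℤ} (ht : t % 4 = 1)
    (htq : t ^ 2 < 4 * 2 ^ m) : ∃ lam : GaloisField 2 m, lam ≠ 0 ∧
      2 * (Set.ncard {X | X ≠ 0 ∧
        Algebra.trace (ZMod 2) (GaloisField 2 m) (lam * (X + X⁻¹)) = 0} : ℤ) = 2 ^ m - 1 - t ∧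
      2 * (Set.ncard {X | X ≠ 0 ∧
        Algebra.trace (ZMod 2) (GaloisField 2 m) (lam * (X + X⁻¹)) = 1} : ℤ) = 2 ^ m - 1 + t := by
  obtain ⟨V, h2⟩ := exists_valuationSubring_two
  obtain ⟨α, β, h, hβ⟩ := exists_frobeniusRoots h2 (by omega : m ≠ 0) (by
    rw [Int.odd_iff]; omega) htq
  let K := AlgebraicClosure (IsLocalRing.ResidueField V)
  let ρ : V →+* K := (algebraMap (IsLocalRing.ResidueField V) K).comp (IsLocalRing.residue V)
  have hρ : ∀ a : V, ρ a = 0 ↔ V.valuation a < 1 := by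
    intro a
    rw [← V.valuation_lt_one_iff, ← IsLocalRing.residue_eq_zero_iff]
    simp [ρ]
  have : CharP K 2 := CharTwo.of_one_ne_zero_of_two_eq_zero one_ne_zero (by
    rw [← map_ofNat ρ 2, hρ]
    exact h2)
  let _ : Algebra (ZMod 2) K := ZMod.algebra K 2
  let ι : GaloisField 2 m →+* K := (IsAlgClosed.lift (R := ZMod 2) (S := GaloisField 2 m)).toRingHom
  have hom := h.isHomothety hm ht
  obtain ⟨a, ha⟩ := IsAlgClosed.exists_pow_nat_eq (h.periodPair.e₁ - h.periodPair.e₃) two_pos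
  obtain ⟨s, hs1, hs⟩ := h.periodPair.exists_scale_eq hom ha
  have hprod : V.valuation (∏ i ∈ Finset.range m, (1 + 4 * (h.periodPair.halfIter i).modU)) = 1 := by
    have h3 := h.periodPair.prod_modU_sq hom
    generalize ∏ i ∈ Finset.range m, (1 + 4 * (h.periodPair.halfIter i).modU) = P at h3 ⊢
    have h4 : (P * β) ^ 2 = 1 := by
      refine mul_left_cancel₀ (pow_ne_zero 2 h.ne_zero_left) ?_
      calc α ^ 2 * (P * β) ^ 2 = P ^ 2 * (α * β) ^ 2 := by ring
        _ = α ^ 2 * 1 := by rw [h.mul, ← h3]; ring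
    have h5 := congrArg V.valuation h4
    rw [map_pow, map_one, map_mul, hβ, mul_one] at h5
    exact (pow_left_inj₀ zero_le zero_le two_ne_zero).mp (by rw [h5, one_pow])
  obtain ⟨U, hU0, hU, hpts⟩ := exists_frobeniusPoints ρ hρ (by omega)
    (h.periodPair.landenCycle_halfIter hom.modU) h2 hprod ι
  have hcard : ∀ (δ : ℤ) (ε : ZMod 2), (δ = 1 ∨ δ = -1) → (s * δ = 1 ∧ ε = 0 ∨ s * δ = -1 ∧ ε = 1) →
      ∃ S : Set K, FrobeniusPoints ι U ε S ∧ 2 * (S.ncard : ℤ) = 2 ^ m - 1 - δ * t := by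
    intro δ ε hδ hε
    have hpos : 0 < (2 : ℤ) ^ m + 1 - δ * t := by
      have : (δ * t) ^ 2 < 4 * 2 ^ m := by rcases hδ with rfl | rfl <;> simpa using htq
      nlinarith [sq_nonneg ((2 : ℤ) ^ m - 1)]
    obtain ⟨N, hN⟩ := Int.eq_ofNat_of_zero_le hpos.le
    have hmem := h.mul_inv_mem_iff hδ (N := N) hN.symm
    have h2z : ∀ j ∈ Finset.Ioo 0 (N / 2), 2 * ((j : ℂ) * (α - δ)⁻¹) ∉ h.periodPair.lattice := by
      intro j hj
      rw [Finset.mem_Ioo] at hj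
      rw [← mul_assoc]
      have := (hmem (2 * j)).not.mpr (fun hd ↦ by
        have := Int.le_of_dvd (by omega) hd
        omega)
      simpa using this
    obtain ⟨S, hS, hSc⟩ := hpts (s * δ) ε hε (Finset.Ioo 0 (N / 2)) _ _ (fun j hj ↦ by
      have := h.periodPair.landenPoint hom ha hs (δ := δ) (by exact_mod_cast hδ) (h2z j hj) (by
        rw [← sub_mul, mul_left_comm, mul_inv_cancel₀ (h.sub_intCast_ne_zero δ), mul_one]
        exact (h.mem_periodPair _).mpr ⟨j, 0, by simp⟩)
      push_cast
      exact this) (by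
      intro j hj k hk hjk
      have hw := PeriodPair.weierstrassP_eq_of_absc_eq (h2z j hj) (h2z k hk) hjk
      rw [Finset.mem_Ioo] at hj hk
      by_contra hne
      rcases lt_or_gt_of_ne hne with hlt | hlt
      · exact h.periodPair.weierstrassP_mul_ne hmem hj.1 hlt (by omega) hw
      · exact h.periodPair.weierstrassP_mul_ne hmem hk.1 hlt (by omega) hw.symm)
    refine ⟨S, hS, ?_⟩
    rw [hSc, Nat.card_Ioo]
    have h4 : (2 : ℤ) ^ m % 4 = 0 := Int.emod_eq_zero_of_dvd (pow_dvd_pow 2 hm)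
    rcases hδ with rfl | rfl <;> omega
  have h01 : ∃ ε : ZMod 2, (s = 1 ∧ ε = 0 ∨ s = -1 ∧ ε = 1) := by
    rcases hs1 with rfl | rfl
    · exact ⟨0, Or.inl ⟨rfl, rfl⟩⟩
    · exact ⟨1, Or.inr ⟨rfl, rfl⟩⟩
  obtain ⟨ε, hε⟩ := h01
  obtain ⟨S, hS, hSc⟩ := hcard 1 ε (Or.inl rfl) (by simpa using hε)
  obtain ⟨T, hT, hTc⟩ := hcard (-1) (ε + 1) (Or.inr rfl) (by
    rcases hε with ⟨rfl, rfl⟩ | ⟨rfl, rfl⟩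
    · exact Or.inr ⟨rfl, rfl⟩
    · exact Or.inl ⟨rfl, rfl⟩)
  exact exists_card_trace hm ι hU0 hU ht hS hT (by linarith) (by linarith)

lemma floor_two_mul_sqrt_sq_le (m : ℕ) : ⌊2 * Real.sqrt (2 ^ m)⌋ ^ 2 ≤ (4 : ℤ) * 2 ^ m := by
  have h0 : (0 : ℤ) ≤ ⌊2 * Real.sqrt (2 ^ m)⌋ := Int.floor_nonneg.mpr (by positivity)
  have h1 := Int.floor_le (2 * Real.sqrt (2 ^ m))
  have h2 : ((⌊2 * Real.sqrt (2 ^ m)⌋ : ℤ) : ℝ) ^ 2 ≤ 4 * 2 ^ m := by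
    calc ((⌊2 * Real.sqrt (2 ^ m)⌋ : ℤ) : ℝ) ^ 2 ≤ (2 * Real.sqrt (2 ^ m)) ^ 2 :=
          pow_le_pow_left₀ (by exact_mod_cast h0) h1 2
      _ = 4 * 2 ^ m := by rw [mul_pow, Real.sq_sqrt (by positivity)]; norm_num
  exact_mod_cast h2

lemma sq_lt_of_abs_le_floor {m : ℕ} {t : ℤ} (ht : t % 4 = 1)
    (h : |t| ≤ ⌊2 * Real.sqrt (2 ^ m)⌋) : t ^ 2 < 4 * 2 ^ m := by
  refine lt_of_le_of_ne ?_ ?_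
  · rw [← sq_abs]
    exact (pow_le_pow_left₀ (abs_nonneg t) h 2).trans (floor_two_mul_sqrt_sq_le m)
  · intro heq
    have h1 : Odd (t ^ 2) := Odd.pow (Int.odd_iff.mpr (by omega))
    rw [heq, Int.odd_iff] at h1
    omega

lemma trace_one_of_odd {m : ℕ} (hm : Odd m) :
    Algebra.trace (ZMod 2) (GaloisField 2 m) 1 = 1 := by
  have h := Algebra.trace_algebraMap (R := ZMod 2) (S := GaloisField 2 m) 1
  rw [map_one, GaloisField.finrank 2 hm.pos.ne', nsmul_one] at h
  rw [h]
  exact (ZMod.natCast_eq_one_iff_odd).mpr hm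

lemma abs_le_floor_of_bounds {m : ℕ} {M c : ℤ}
    (h1 : ((2 ^ m : ℝ) - c - ⌊2 * Real.sqrt (2 ^ m)⌋) / 4 ≤ (M : ℝ))
    (h2 : (M : ℝ) ≤ ((2 ^ m : ℝ) - c + ⌊2 * Real.sqrt (2 ^ m)⌋) / 4) :
    |4 * M - 2 ^ m + c| ≤ ⌊2 * Real.sqrt (2 ^ m)⌋ := by
  rw [abs_le]
  constructor
  · have : ((2 ^ m : ℝ) - c - ⌊2 * Real.sqrt (2 ^ m)⌋) ≤ 4 * M := by linarith
    have : ((2 ^ m : ℤ) - c - ⌊2 * Real.sqrt (2 ^ m)⌋) ≤ 4 * M := by exact_mod_cast this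
    linarith
  · have : (4 * M : ℝ) ≤ ((2 ^ m : ℝ) - c + ⌊2 * Real.sqrt (2 ^ m)⌋) := by linarith
    have : 4 * M ≤ ((2 ^ m : ℤ) - c + ⌊2 * Real.sqrt (2 ^ m)⌋) := by exact_mod_cast this
    linarith

lemma ne_zero_ne_one_eq_empty (P : GaloisField 2 1 → Prop) : {x | x ≠ 0 ∧ x ≠ 1 ∧ P x} = ∅ := by
  ext x
  have h01 : ∀ a : ZMod 2, a = 0 ∨ a = 1 := by decide
  have : x = 0 ∨ x = 1 := by
    simpa using h01 (GaloisField.equivZmodP 2 x)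
  simp only [Set.mem_ofPred_eq, Set.mem_empty_iff_false, iff_false]
  tauto

lemma sq_floor_lt_of_one : ⌊2 * Real.sqrt (2 ^ 1)⌋ ≤ 2 := by
  have h := floor_two_mul_sqrt_sq_le 1
  nlinarith

/-- for `q = 2^m` with `m` odd and `f₃ = λx + λx⁻¹ + A + 1`, the
half-count `M(f₃)` of completely splitting points assumes every integer value
in `[(q−3−⌊2√q⌋)/4, (q−3+⌊2√q⌋)/4]` for suitable `λ ≠ 0` and `A` with
`Tr(A+1) = 0`, and every integer value in `[(q−1−⌊2√q⌋)/4, (q−1+⌊2√q⌋)/4]`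
for suitable `λ ≠ 0` and `A` with `Tr(A+1) = 1`. -/
theorem M_f3_assumes_all_values (m : ℕ) (hm : Odd m) :
    (∀ M₀ : ℤ,
      ((2 ^ m : ℝ) - 3 - ⌊2 * Real.sqrt (2 ^ m)⌋) / 4 ≤ (M₀ : ℝ) →
      (M₀ : ℝ) ≤ ((2 ^ m : ℝ) - 3 + ⌊2 * Real.sqrt (2 ^ m)⌋) / 4 →
      ∃ lam A : GaloisField 2 m, lam ≠ 0 ∧
        Algebra.trace (ZMod 2) (GaloisField 2 m) (A + 1) = 0 ∧
        (Set.ncard {x : GaloisField 2 m | x ≠ 0 ∧ x ≠ 1 ∧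
            Algebra.trace (ZMod 2) (GaloisField 2 m)
              (lam * x + lam * x⁻¹ + A + 1) = 0} : ℝ) / 2 = (M₀ : ℝ)) ∧
    (∀ M₀ : ℤ,
      ((2 ^ m : ℝ) - 1 - ⌊2 * Real.sqrt (2 ^ m)⌋) / 4 ≤ (M₀ : ℝ) →
      (M₀ : ℝ) ≤ ((2 ^ m : ℝ) - 1 + ⌊2 * Real.sqrt (2 ^ m)⌋) / 4 →
      ∃ lam A : GaloisField 2 m, lam ≠ 0 ∧
        Algebra.trace (ZMod 2) (GaloisField 2 m) (A + 1) = 1 ∧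
        (Set.ncard {x : GaloisField 2 m | x ≠ 0 ∧ x ≠ 1 ∧
            Algebra.trace (ZMod 2) (GaloisField 2 m)
              (lam * x + lam * x⁻¹ + A + 1) = 0} : ℝ) / 2 = (M₀ : ℝ)) := by
  obtain rfl | hm2 : m = 1 ∨ 2 ≤ m := by have := hm.pos; omega
  · have hfl := sq_floor_lt_of_one
    constructor
    · intro M h1 h2
      have h := abs_le.mp ((abs_le_floor_of_bounds (c := 3) (by exact_mod_cast h1)
        (by exact_mod_cast h2)).trans hfl)
      obtain rfl : M = 0 := by omega
      refine ⟨1, 1, one_ne_zero, by rw [CharTwo.add_self_eq_zero, map_zero], ?_⟩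
      rw [ne_zero_ne_one_eq_empty]
      simp
    · intro M h1 h2
      have h := abs_le.mp ((abs_le_floor_of_bounds (c := 1) (by exact_mod_cast h1)
        (by exact_mod_cast h2)).trans hfl)
      obtain rfl : M = 0 := by omega
      refine ⟨1, 0, one_ne_zero, by rw [zero_add, trace_one_of_odd hm], ?_⟩
      rw [ne_zero_ne_one_eq_empty]
      simp
  have h4 : (2 : ℤ) ^ m % 4 = 0 := Int.emod_eq_zero_of_dvd (pow_dvd_pow 2 hm2)
  constructor
  · intro M h1 h2
    have h := abs_le_floor_of_bounds (c := 3) (by exact_mod_cast h1) (by exact_mod_cast h2)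
    rw [← abs_neg] at h
    obtain ⟨lam, hlam, h0, -⟩ := exists_card_trace_eq hm2 (t := -(4 * M - 2 ^ m + 3)) (by omega)
      (sq_lt_of_abs_le_floor (by omega) h)
    refine ⟨lam, 1, hlam, by rw [CharTwo.add_self_eq_zero, map_zero], ?_⟩
    have hset : {X : GaloisField 2 m | X ≠ 0 ∧
          Algebra.trace (ZMod 2) (GaloisField 2 m) (lam * (X + X⁻¹)) = 0} =
        insert 1 {x : GaloisField 2 m | x ≠ 0 ∧ x ≠ 1 ∧
          Algebra.trace (ZMod 2) (GaloisField 2 m) (lam * x + lam * x⁻¹ + 1 + 1) = 0} := by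
      ext x
      simp only [Set.mem_ofPred_eq, Set.mem_insert_iff, add_assoc _ (1 : GaloisField 2 m),
        CharTwo.add_self_eq_zero, add_zero, ← mul_add]
      by_cases hx : x = 1
      · simp [hx, CharTwo.add_self_eq_zero]
      · simp [hx]
    rw [hset, Set.ncard_insert_of_notMem (by simp)] at h0
    have h5 : ((Set.ncard {x : GaloisField 2 m | x ≠ 0 ∧ x ≠ 1 ∧
          Algebra.trace (ZMod 2) (GaloisField 2 m) (lam * x + lam * x⁻¹ + 1 + 1) = 0} : ℤ)) =
        2 * M := by
      push_cast at h0
      linarith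
    rw [div_eq_iff two_ne_zero, mul_comm]
    exact_mod_cast h5
  · intro M h1 h2
    have h := abs_le_floor_of_bounds (c := 1) (by exact_mod_cast h1) (by exact_mod_cast h2)
    obtain ⟨lam, hlam, -, h0⟩ := exists_card_trace_eq hm2 (t := 4 * M - 2 ^ m + 1) (by omega)
      (sq_lt_of_abs_le_floor (by omega) h)
    refine ⟨lam, 0, hlam, by rw [zero_add, trace_one_of_odd hm], ?_⟩
    have hset : {x : GaloisField 2 m | x ≠ 0 ∧ x ≠ 1 ∧
          Algebra.trace (ZMod 2) (GaloisField 2 m) (lam * x + lam * x⁻¹ + 0 + 1) = 0} =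
        {X : GaloisField 2 m | X ≠ 0 ∧
          Algebra.trace (ZMod 2) (GaloisField 2 m) (lam * (X + X⁻¹)) = 1} := by
      have h01 : ∀ a : ZMod 2, a + 1 = 0 ↔ a = 1 := by decide
      ext x
      simp only [Set.mem_ofPred_eq, add_zero, ← mul_add, map_add, trace_one_of_odd hm, h01]
      by_cases hx : x = 1
      · simp [hx, CharTwo.add_self_eq_zero]
      · simp [hx]
    rw [hset, div_eq_iff two_ne_zero, mul_comm]
    have h5 : ((Set.ncard {X : GaloisField 2 m | X ≠ 0 ∧
          Algebra.trace (ZMod 2) (GaloisField 2 m) (lam * (X + X⁻¹)) = 1} : ℤ)) = 2 * M := by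
      linarith
    exact_mod_cast h5
end

section
/- Let q = 2^m with m odd, and let A, B ∈ F_q with λ := A² + A + 1 + B ≠ 0. Define functions on F_q∖{0}: f₁(x) = λ(x³+x), f₂(x) = λ(x⁻³+x⁻¹), f₃(x) = λ(x+x⁻¹), f₄ = f₁+f₂, f₅ = f₁+f₃, f₆ = f₂+f₃, f₇ = f₁+f₂+f₃, and set n_i = #{x ∈ F_q∖{0} : Tr(f_i(x)) = 0} for i = 1,…,7. Then N(A,B) = (2q − 2 − 2(n₁ + n₂ + n₃ − n₄ − n₅ − n₆ + n₇))/24 if Tr(A) = 0, and N(A,B) = (−6q − 2 + 2(n₁+n₂+n₃+n₄+n₅+n₆+n₇))/24 if Tr(A) = 1. -/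
open Finset

section CharTwoIdentities

variable {F : Type*} [Field F] [CharP F 2]

theorem add_ne_zero_of_injective {ι : Type*} {e : ι → F} (he : Function.Injective e) {i j : ι}
    (hij : i ≠ j) : e i + e j ≠ 0 :=
  fun h => hij (he (CharTwo.add_eq_zero.mp h))

theorem ne_of_powerSums {a b c d A B l : F} (hl : l = A ^ 2 + A + 1 + B) (hl0 : l ≠ 0)
    (h₁ : a + b + c + d = 1) (h₃ : a ^ 3 + b ^ 3 + c ^ 3 + d ^ 3 = A)
    (h₅ : a ^ 5 + b ^ 5 + c ^ 5 + d ^ 5 = B) : a ≠ c := by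
  rintro rfl
  apply hl0
  have hd : d = 1 + b := by grind
  subst hl h₃ h₅ hd
  grind

theorem injective_of_powerSums {a b c d A B l : F} (hl : l = A ^ 2 + A + 1 + B) (hl0 : l ≠ 0)
    (h₁ : a + b + c + d = 1) (h₃ : a ^ 3 + b ^ 3 + c ^ 3 + d ^ 3 = A)
    (h₅ : a ^ 5 + b ^ 5 + c ^ 5 + d ^ 5 = B) : Function.Injective ![a, b, c, d] := by
  have hac : a ≠ c := ne_of_powerSums hl hl0 h₁ h₃ h₅
  have hab : a ≠ b := ne_of_powerSums (b := c) (d := d) hl hl0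
    (by linear_combination h₁) (by linear_combination h₃) (by linear_combination h₅)
  have had : a ≠ d := ne_of_powerSums (b := b) (d := c) hl hl0
    (by linear_combination h₁) (by linear_combination h₃) (by linear_combination h₅)
  have hbc : b ≠ c := ne_of_powerSums (b := a) (d := d) hl hl0
    (by linear_combination h₁) (by linear_combination h₃) (by linear_combination h₅)
  have hbd : b ≠ d := ne_of_powerSums (b := a) (d := c) hl hl0
    (by linear_combination h₁) (by linear_combination h₃) (by linear_combination h₅)
  have hcd : c ≠ d := ne_of_powerSums (b := a) (d := b) hl hl0
    (by linear_combination h₁) (by linear_combination h₃) (by linear_combination h₅)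
  intro i j
  fin_cases i <;> fin_cases j <;> simp [*, Ne.symm]

theorem resolvent_eq {a b c d A B l z s : F} (hl : l = A ^ 2 + A + 1 + B)
    (h₁ : a + b + c + d = 1) (h₃ : a ^ 3 + b ^ 3 + c ^ 3 + d ^ 3 = A)
    (h₅ : a ^ 5 + b ^ 5 + c ^ 5 + d ^ 5 = B) (hs : s = a + b) (hz : z = s + a * b + c * d) :
    s * (s + 1) * (z ^ 2 + z + A + 1) = l := by
  have hd : d = 1 + a + b + c := by grind
  subst hz hs hl h₃ h₅ hd
  clear h₁
  grind

theorem first_pair_eq {a b c d A z s g : F} (h₁ : a + b + c + d = 1)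
    (h₃ : a ^ 3 + b ^ 3 + c ^ 3 + d ^ 3 = A) (hs : s = a + b) (hz : z = s + a * b + c * d)
    (hg : s * g = a + z) : s ^ 2 * (g ^ 2 + g) = z ^ 2 + z + A + 1 := by
  have hd : d = 1 + a + b + c := by grind
  have hsg : s ^ 2 * (g ^ 2 + g) = (s * g) ^ 2 + s * (s * g) := by ring
  rw [hsg, hg]
  subst hz hs h₃ hd
  clear h₁ hg hsg
  grind

theorem second_pair_eq {a b c d A z s h : F} (h₁ : a + b + c + d = 1)
    (h₃ : a ^ 3 + b ^ 3 + c ^ 3 + d ^ 3 = A) (hs : s = a + b) (hz : z = s + a * b + c * d)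
    (hh : (s + 1) * h = c + z + 1) : (s + 1) ^ 2 * (h ^ 2 + h) = z ^ 2 + z + A + 1 := by
  have hd : d = 1 + a + b + c := by grind
  have hsh : (s + 1) ^ 2 * (h ^ 2 + h) = ((s + 1) * h) ^ 2 + (s + 1) * ((s + 1) * h) := by ring
  rw [hsh, hh]
  subst hz hs h₃ hd
  clear h₁ hh hsh
  grind

theorem powerSums_of_resolvent {A B l s z g h a b c d : F} (hl : l = A ^ 2 + A + 1 + B)
    (hz : s * (s + 1) * (z ^ 2 + z + A + 1) = l)
    (hg : s ^ 2 * (g ^ 2 + g) = z ^ 2 + z + A + 1)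
    (hh : (s + 1) ^ 2 * (h ^ 2 + h) = z ^ 2 + z + A + 1)
    (ha : a = s * g + z) (hb : b = s * g + z + s)
    (hc : c = (s + 1) * h + z + 1) (hd : d = (s + 1) * h + z + s) :
    a + b + c + d = 1 ∧ a ^ 3 + b ^ 3 + c ^ 3 + d ^ 3 = A ∧
      a ^ 5 + b ^ 5 + c ^ 5 + d ^ 5 = B := by
  subst ha hb hc hd
  refine ⟨?_, ?_, ?_⟩ <;> grind

theorem resolvent_iff_div {A l s z g h : F} (hs : s ≠ 0) (hr : s + 1 ≠ 0) :
    (z ^ 2 + z = l / (s * (s + 1)) + (A + 1) ∧ g ^ 2 + g = l / (s ^ 3 * (s + 1)) ∧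
        h ^ 2 + h = l / (s * (s + 1) ^ 3)) ↔
      s * (s + 1) * (z ^ 2 + z + A + 1) = l ∧ s ^ 2 * (g ^ 2 + g) = z ^ 2 + z + A + 1 ∧
        (s + 1) ^ 2 * (h ^ 2 + h) = z ^ 2 + z + A + 1 := by
  have hz : z ^ 2 + z = l / (s * (s + 1)) + (A + 1) ↔
      z ^ 2 + z + A + 1 = l / (s * (s + 1)) := by
    constructor <;> intro <;> grind
  rw [hz, mul_comm (s * (s + 1)), ← eq_div_iff (mul_ne_zero hs hr)]
  refine and_congr_right fun hz => ?_
  have hsr : s ^ 2 * (l / (s ^ 3 * (s + 1))) = l / (s * (s + 1)) := by field_simp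
  have hrs : (s + 1) ^ 2 * (l / (s * (s + 1) ^ 3)) = l / (s * (s + 1)) := by field_simp
  rw [hz, ← mul_right_inj' (pow_ne_zero 2 hs), hsr,
    ← mul_right_inj' (b := h ^ 2 + h) (pow_ne_zero 2 hr), hrs]

end CharTwoIdentities

section TraceSign

variable {F : Type*} [Field F] [Algebra (ZMod 2) F]

/-- The canonical additive character of `F`, with values `1` and `-1`. -/
noncomputable def traceSign (a : F) : ℤ := if Algebra.trace (ZMod 2) F a = 0 then 1 else -1

theorem traceSign_zero : traceSign (0 : F) = 1 := by simp [traceSign]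

theorem traceSign_add (a b : F) : traceSign (a + b) = traceSign a * traceSign b := by
  have key : ∀ s t : ZMod 2, (if s + t = 0 then (1 : ℤ) else -1) =
      (if s = 0 then 1 else -1) * (if t = 0 then 1 else -1) := by decide
  simp only [traceSign, map_add, key]

theorem traceSign_eq_or (a : F) : traceSign a = 1 ∨ traceSign a = -1 := by
  unfold traceSign
  split_ifs <;> simp

theorem traceSign_one (h : Odd (Module.finrank (ZMod 2) F)) : traceSign (1 : F) = -1 := by
  have h1 : Algebra.trace (ZMod 2) F 1 = 1 := by
    rw [← map_one (algebraMap (ZMod 2) F), Algebra.trace_algebraMap, nsmul_one,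
      ZMod.natCast_eq_one_iff_odd.mpr h]
  simp [traceSign, h1]

theorem two_mul_ncard_trace_eq_zero [Fintype F] [DecidableEq F] (f : F → F) :
    2 * ({x : F | x ≠ 0 ∧ Algebra.trace (ZMod 2) F (f x) = 0}.ncard : ℤ) =
      ∑ x ∈ univ.erase (0 : F), (1 + traceSign (f x)) := by
  have hset : {x : F | x ≠ 0 ∧ Algebra.trace (ZMod 2) F (f x) = 0} =
      ↑({x ∈ univ.erase (0 : F) | Algebra.trace (ZMod 2) F (f x) = 0} : Finset F) := by
    ext x
    simp
  rw [hset, Set.ncard_coe_finset, card_filter, Nat.cast_sum, mul_sum]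
  refine sum_congr rfl fun x _ => ?_
  unfold traceSign
  split_ifs <;> simp

variable [Fintype F] [CharP F 2]

theorem trace_sq (a : F) : Algebra.trace (ZMod 2) F (a ^ 2) = Algebra.trace (ZMod 2) F a := by
  have := Algebra.trace_eq_of_algEquiv (FiniteField.frobeniusAlgEquiv (ZMod 2) F 2) a
  simpa [ZMod.card] using this

theorem exists_sq_add_self_eq_iff (a : F) :
    (∃ z, z ^ 2 + z = a) ↔ Algebra.trace (ZMod 2) F a = 0 := by
  let φ : F →ₗ[ZMod 2] F := (FiniteField.frobeniusAlgHom (ZMod 2) F).toLinearMap + LinearMap.id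
  have hφ (z : F) : φ z = z ^ 2 + z := by simp [φ, ZMod.card]
  have hker : LinearMap.ker φ = Submodule.span (ZMod 2) {1} := by
    ext z
    rw [LinearMap.mem_ker, Submodule.mem_span_singleton]
    constructor
    · intro hz
      rw [hφ] at hz
      have h01 : z = 0 ∨ z = 1 := by
        rw [← sub_eq_zero (b := (1 : F)), ← mul_eq_zero]
        grind
      rcases h01 with rfl | rfl
      · exact ⟨0, by simp⟩
      · exact ⟨1, by simp⟩
    · rintro ⟨t, rfl⟩
      rw [map_smul, hφ, one_pow, CharTwo.add_self_eq_zero, smul_zero]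
  have hle : LinearMap.range φ ≤ LinearMap.ker (Algebra.trace (ZMod 2) F) := by
    rintro _ ⟨z, rfl⟩
    rw [LinearMap.mem_ker, hφ, map_add, trace_sq, CharTwo.add_self_eq_zero]
  have h1 := LinearMap.finrank_range_add_finrank_ker φ
  have h2 := LinearMap.finrank_range_add_finrank_ker (Algebra.trace (ZMod 2) F)
  rw [hker, finrank_span_singleton one_ne_zero] at h1
  rw [LinearMap.range_eq_top.mpr (Algebra.trace_surjective (ZMod 2) F), finrank_top,
    Module.finrank_self] at h2
  have heq := Submodule.eq_of_le_of_finrank_eq hle (by omega)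
  rw [← LinearMap.mem_ker, ← heq]
  simp [hφ]

theorem card_filter_sq_add_self_eq [DecidableEq F] (a : F) :
    (#{z : F | z ^ 2 + z = a} : ℤ) = 1 + traceSign a := by
  unfold traceSign
  split_ifs with h
  · obtain ⟨z, rfl⟩ := (exists_sq_add_self_eq_iff a).mpr h
    have hpair : ({w : F | w ^ 2 + w = z ^ 2 + z} : Finset F) = {z, z + 1} := by
      ext w
      have hw : w = z ∨ w = z + 1 ↔ (w - z) * (w - (z + 1)) = 0 := by
        rw [mul_eq_zero, sub_eq_zero, sub_eq_zero]
      simp only [mem_filter_univ, mem_insert, mem_singleton, hw]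
      constructor <;> intro <;> grind
    rw [hpair, card_pair (by simp)]
    norm_num
  · rw [filter_eq_empty_iff.mpr fun z _ hz => h ((exists_sq_add_self_eq_iff a).mp ⟨z, hz⟩)]
    simp

end TraceSign

theorem card_injective_image_mem {α : Type*} [Fintype α] [DecidableEq α] {k : ℕ}
    (S : Finset (Finset α)) (hS : ∀ s ∈ S, #s = k) :
    #{e : Fin k → α | Function.Injective e ∧ univ.image e ∈ S} = k.factorial * #S := by
  rw [card_eq_sum_card_fiberwise (f := fun e : Fin k → α => univ.image e) (t := S)
    (fun e he => by simpa using (mem_filter.mp he).2.2), mul_comm, ← smul_eq_mul, ← sum_const]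
  refine sum_congr rfl fun s hs => ?_
  have hc : Fintype.card (Fin k) = Fintype.card s := by simp [hS s hs]
  have hk : k.factorial = Fintype.card (Fin k ≃ s) := by
    rw [Fintype.card_equiv (Fintype.equivOfCardEq hc), Fintype.card_fin]
  rw [hk, ← card_univ]
  symm
  refine card_bij (fun e _ i => (e i : α)) ?_ ?_ ?_
  · intro e _
    have himg : univ.image (fun i => (e i : α)) = s := by
      ext x
      simp only [mem_image, mem_univ, true_and]
      exact ⟨by rintro ⟨i, rfl⟩; exact (e i).2, fun hx => ⟨e.symm ⟨x, hx⟩, by simp⟩⟩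
    simp only [mem_filter, mem_univ, true_and, himg, hs, and_true]
    exact Subtype.val_injective.comp e.injective
  · intro e _ e' _ h
    ext i
    exact congrFun h i
  · intro e he
    simp only [mem_filter, mem_univ, true_and] at he
    obtain ⟨⟨hinj, -⟩, himg⟩ := he
    have hmem (i : Fin k) : e i ∈ s := himg ▸ mem_image_of_mem e (mem_univ i)
    refine ⟨Equiv.ofBijective (fun i => ⟨e i, hmem i⟩) ?_, mem_univ _, rfl⟩
    exact (Fintype.bijective_iff_injective_and_card _).mpr
      ⟨fun i j h => hinj (congrArg Subtype.val h), hc⟩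

section Counting

variable {F : Type*} [Field F] [Fintype F] [DecidableEq F]

theorem factorial_mul_ncard_powerSums (A B : F) :
    24 * {s : Finset F | #s = 4 ∧ (∑ x ∈ s, x) = 1 ∧ (∑ x ∈ s, x ^ 3) = A ∧
        (∑ x ∈ s, x ^ 5) = B}.ncard =
      #{e : Fin 4 → F | Function.Injective e ∧ (∑ i, e i) = 1 ∧ (∑ i, e i ^ 3) = A ∧
        (∑ i, e i ^ 5) = B} := by
  let S : Finset (Finset F) := {s | #s = 4 ∧ (∑ x ∈ s, x) = 1 ∧ (∑ x ∈ s, x ^ 3) = A ∧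
    (∑ x ∈ s, x ^ 5) = B}
  have hset : {s : Finset F | #s = 4 ∧ (∑ x ∈ s, x) = 1 ∧ (∑ x ∈ s, x ^ 3) = A ∧
      (∑ x ∈ s, x ^ 5) = B} = ↑S := by
    ext s
    simp [S]
  rw [hset, Set.ncard_coe_finset,
    ← show Nat.factorial 4 = 24 from rfl,
    ← card_injective_image_mem S fun s hs => (mem_filter.mp hs).2.1]
  congr 1
  refine filter_congr fun e _ => and_congr_right fun he => ?_
  simp [S, sum_image he.injOn, card_image_of_injective _ he]

theorem card_powerSums_eq_sum [CharP F 2] {A B l : F} (hl : l = A ^ 2 + A + 1 + B) (hl0 : l ≠ 0) :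
    #{e : Fin 4 → F | Function.Injective e ∧ (∑ i, e i) = 1 ∧ (∑ i, e i ^ 3) = A ∧
        (∑ i, e i ^ 5) = B} =
      ∑ s ∈ {s : F | s ≠ 0 ∧ s + 1 ≠ 0},
        #{z : F | z ^ 2 + z = l / (s * (s + 1)) + (A + 1)} *
          (#{g : F | g ^ 2 + g = l / (s ^ 3 * (s + 1))} *
            #{h : F | h ^ 2 + h = l / (s * (s + 1) ^ 3)}) := by
  simp only [← card_product]
  rw [← card_sigma]
  refine card_nbij'
    (fun e => ⟨e 0 + e 1, e 0 + e 1 + e 0 * e 1 + e 2 * e 3,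
      (e 0 + (e 0 + e 1 + e 0 * e 1 + e 2 * e 3)) / (e 0 + e 1),
      (e 2 + (e 0 + e 1 + e 0 * e 1 + e 2 * e 3) + 1) / (e 0 + e 1 + 1)⟩)
    (fun p => ![p.1 * p.2.2.1 + p.2.1, p.1 * p.2.2.1 + p.2.1 + p.1,
      (p.1 + 1) * p.2.2.2 + p.2.1 + 1, (p.1 + 1) * p.2.2.2 + p.2.1 + p.1]) ?_ ?_ ?_ ?_
  · intro e he
    simp only [coe_filter, mem_univ, true_and, Set.mem_ofPred_eq, Fin.sum_univ_four] at he
    obtain ⟨hinj, h₁, h₃, h₅⟩ := he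
    have hs : e 0 + e 1 ≠ 0 := add_ne_zero_of_injective hinj (by decide)
    have hr : e 0 + e 1 + 1 ≠ 0 := by
      have := add_ne_zero_of_injective hinj (show (2 : Fin 4) ≠ 3 by decide)
      grind
    simp only [coe_sigma, Set.mem_sigma_iff, mem_coe, mem_filter, mem_univ, true_and, mem_product]
    exact ⟨⟨hs, hr⟩, (resolvent_iff_div hs hr).mpr ⟨resolvent_eq hl h₁ h₃ h₅ rfl rfl,
      first_pair_eq h₁ h₃ rfl rfl (mul_div_cancel₀ _ hs),
      second_pair_eq h₁ h₃ rfl rfl (mul_div_cancel₀ _ hr)⟩⟩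
  · rintro ⟨s, z, g, h⟩ hp
    simp only [coe_sigma, Set.mem_sigma_iff, mem_coe, mem_filter, mem_univ, true_and,
      mem_product] at hp
    obtain ⟨⟨hs, hr⟩, hp⟩ := hp
    obtain ⟨hz, hg, hh⟩ := (resolvent_iff_div hs hr).mp hp
    obtain ⟨h₁, h₃, h₅⟩ := powerSums_of_resolvent hl hz hg hh rfl rfl rfl rfl
    simp only [coe_filter, mem_univ, true_and, Set.mem_ofPred_eq, Fin.sum_univ_four]
    exact ⟨injective_of_powerSums hl hl0 h₁ h₃ h₅, h₁, h₃, h₅⟩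
  · intro e he
    simp only [coe_filter, mem_univ, true_and, Set.mem_ofPred_eq, Fin.sum_univ_four] at he
    obtain ⟨hinj, h₁, -, -⟩ := he
    have hs : e 0 + e 1 ≠ 0 := add_ne_zero_of_injective hinj (by decide)
    have hr : e 0 + e 1 + 1 ≠ 0 := by
      have := add_ne_zero_of_injective hinj (show (2 : Fin 4) ≠ 3 by decide)
      grind
    ext i
    fin_cases i <;> simp [mul_div_cancel₀ _ hs, mul_div_cancel₀ _ hr] <;> grind
  · rintro ⟨s, z, g, h⟩ hp
    simp only [coe_sigma, Set.mem_sigma_iff, mem_coe, mem_filter, mem_univ, true_and,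
      mem_product] at hp
    obtain ⟨⟨hs, hr⟩, hp⟩ := hp
    obtain ⟨hz, hg, hh⟩ := (resolvent_iff_div hs hr).mp hp
    have es : s * g + z + (s * g + z + s) = s := by grind
    have ez : s + (s * g + z) * (s * g + z + s) +
        ((s + 1) * h + z + 1) * ((s + 1) * h + z + s) = z := by grind
    have eg : (s * g + z + z) / s = g := by
      rw [add_assoc, CharTwo.add_self_eq_zero, add_zero, mul_div_cancel_left₀ _ hs]
    have eh : ((s + 1) * h + z + 1 + z + 1) / (s + 1) = h := by
      rw [show (s + 1) * h + z + 1 + z + 1 = (s + 1) * h by grind, mul_div_cancel_left₀ _ hr]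
    simp [es, ez, eg, eh]

end Counting

section Formula

variable {F : Type*} [Field F] [Fintype F] [DecidableEq F] [Algebra (ZMod 2) F] [CharP F 2]
  {A B l : F}

theorem card_powerSums_eq_sum_traceSign (hl : l = A ^ 2 + A + 1 + B) (hl0 : l ≠ 0) :
    (#{e : Fin 4 → F | Function.Injective e ∧ (∑ i, e i) = 1 ∧ (∑ i, e i ^ 3) = A ∧
        (∑ i, e i ^ 5) = B} : ℤ) =
      ∑ x ∈ (univ.erase (0 : F)).erase 1,
        (1 + traceSign (l * (x + x⁻¹) + (A + 1))) *
          ((1 + traceSign (l * ((x ^ 3)⁻¹ + x⁻¹) + l * (x + x⁻¹))) *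
            (1 + traceSign (l * (x ^ 3 + x) + l * (x + x⁻¹)))) := by
  rw [card_powerSums_eq_sum hl hl0]
  push_cast
  simp only [card_filter_sq_add_self_eq]
  have hdiv (s : F) (hr : s + 1 ≠ 0) : s / (s + 1) + 1 = (s + 1)⁻¹ := by
    rw [div_add_one hr, show s + (s + 1) = 1 by grind, one_div]
  have hinv (s : F) (hr : s + 1 ≠ 0) : s / (s + 1) / (s / (s + 1) + 1) = s := by
    rw [hdiv s hr, div_inv_eq_mul, div_mul_cancel₀ _ hr]
  have hne (s : F) (hr : s + 1 ≠ 0) : s / (s + 1) ≠ 1 := fun h => by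
    have := hdiv s hr
    rw [h, CharTwo.add_self_eq_zero] at this
    exact inv_ne_zero hr this.symm
  have hne_one {x : F} : x ≠ 1 ↔ x + 1 ≠ 0 := CharTwo.add_eq_zero.not.symm
  refine sum_nbij' (fun s => s / (s + 1)) (fun x => x / (x + 1)) ?_ ?_ ?_ ?_ ?_
  · intro s hs
    simp only [mem_filter, mem_univ, true_and] at hs
    simp [hs.1, hs.2, hne s hs.2]
  · intro x hx
    simp only [mem_erase, mem_univ, and_true] at hx
    have hx1 := hne_one.mp hx.1
    simp [hx.2, hx1, hdiv x hx1]
  · intro s hs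
    simp only [mem_filter, mem_univ, true_and] at hs
    exact hinv s hs.2
  · intro x hx
    simp only [mem_erase, mem_univ, and_true] at hx
    exact hinv x (hne_one.mp hx.1)
  · intro s hs
    simp only [mem_filter, mem_univ, true_and] at hs
    obtain ⟨hs, hr⟩ := hs
    have e₁ : l / (s * (s + 1)) = l * (s / (s + 1) + (s / (s + 1))⁻¹) := by
      field_simp
      grind
    have e₂ : l / (s ^ 3 * (s + 1)) = l * (((s / (s + 1)) ^ 3)⁻¹ + (s / (s + 1))⁻¹) +
        l * (s / (s + 1) + (s / (s + 1))⁻¹) := by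
      field_simp
      grind
    have e₃ : l / (s * (s + 1) ^ 3) = l * ((s / (s + 1)) ^ 3 + s / (s + 1)) +
        l * (s / (s + 1) + (s / (s + 1))⁻¹) := by
      field_simp
      grind
    rw [e₁, e₂, e₃]

theorem card_powerSums_eq_sum_sub (hl : l = A ^ 2 + A + 1 + B) (hl0 : l ≠ 0) :
    (#{e : Fin 4 → F | Function.Injective e ∧ (∑ i, e i) = 1 ∧ (∑ i, e i ^ 3) = A ∧
        (∑ i, e i ^ 5) = B} : ℤ) =
      ∑ x ∈ univ.erase (0 : F),
        (1 + traceSign (l * (x + x⁻¹)) * traceSign (A + 1)) *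
          ((1 + traceSign (l * ((x ^ 3)⁻¹ + x⁻¹)) * traceSign (l * (x + x⁻¹))) *
            (1 + traceSign (l * (x ^ 3 + x)) * traceSign (l * (x + x⁻¹)))) -
        4 * (1 + traceSign (A + 1)) := by
  rw [card_powerSums_eq_sum_traceSign hl hl0,
    ← sum_erase_add (univ.erase (0 : F)) _ (mem_erase.mpr ⟨one_ne_zero, mem_univ (1 : F)⟩)]
  simp only [traceSign_add, one_pow, inv_one, CharTwo.add_self_eq_zero, mul_zero, traceSign_zero]
  ring

end Formula


/-- Proposition (4.1). For `q = 2^m`, `m` odd and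
`λ = A² + A + 1 + B ≠ 0`, with `f₁ = λ(x³+x)`, `f₂ = λ(x⁻³+x⁻¹)`,
`f₃ = λ(x+x⁻¹)`, `f₄ = f₁+f₂`, `f₅ = f₁+f₃`, `f₆ = f₂+f₃`, `f₇ = f₁+f₂+f₃`
and `nᵢ = #{x ≠ 0 : Tr(fᵢ(x)) = 0}`, one has
`N(A,B) = (2q − 2 − 2(n₁+n₂+n₃−n₄−n₅−n₆+n₇))/24` if `Tr(A) = 0`, and
`N(A,B) = (−6q − 2 + 2(n₁+⋯+n₇))/24` if `Tr(A) = 1`. -/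
theorem N_formula
    (m : ℕ) (hm : Odd m) (A B lam : GaloisField 2 m)
    (hlam : lam = A ^ 2 + A + 1 + B) (hlam0 : lam ≠ 0)
    (f : Fin 8 → GaloisField 2 m → GaloisField 2 m)
    (hf1 : f 1 = fun x => lam * (x ^ 3 + x))
    (hf2 : f 2 = fun x => lam * ((x ^ 3)⁻¹ + x⁻¹))
    (hf3 : f 3 = fun x => lam * (x + x⁻¹))
    (hf4 : f 4 = fun x => f 1 x + f 2 x)
    (hf5 : f 5 = fun x => f 1 x + f 3 x)
    (hf6 : f 6 = fun x => f 2 x + f 3 x)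
    (hf7 : f 7 = fun x => f 1 x + f 2 x + f 3 x)
    (n : Fin 8 → ℕ)
    (hn : ∀ i : Fin 8, n i = Set.ncard {x : GaloisField 2 m | x ≠ 0 ∧
      Algebra.trace (ZMod 2) (GaloisField 2 m) (f i x) = 0})
    (N : ℕ)
    (hN : N = Set.ncard {s : Finset (GaloisField 2 m) | s.card = 4 ∧
      (∑ x ∈ s, x) = 1 ∧ (∑ x ∈ s, x ^ 3) = A ∧ (∑ x ∈ s, x ^ 5) = B}) :
    (Algebra.trace (ZMod 2) (GaloisField 2 m) A = 0 →
      24 * (N : ℤ) = 2 * 2 ^ m - 2 -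
        2 * ((n 1 : ℤ) + n 2 + n 3 - n 4 - n 5 - n 6 + n 7)) ∧
    (Algebra.trace (ZMod 2) (GaloisField 2 m) A = 1 →
      24 * (N : ℤ) = -6 * 2 ^ m - 2 +
        2 * ((n 1 : ℤ) + n 2 + n 3 + n 4 + n 5 + n 6 + n 7)) := by
  classical
  have hm0 : m ≠ 0 := hm.pos.ne'
  let _ : Fintype (GaloisField 2 m) := Fintype.ofFinite _
  have hq : ∑ x ∈ univ.erase (0 : GaloisField 2 m), (1 : ℤ) = 2 ^ m - 1 := by
    rw [sum_const, card_erase_of_mem (mem_univ _), card_univ, Fintype.card_eq_nat_card,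
      GaloisField.card 2 m hm0, nsmul_one, Nat.cast_sub Nat.one_le_two_pow]
    push_cast
    rfl
  have hψ1 : traceSign (1 : GaloisField 2 m) = -1 :=
    traceSign_one (by rwa [GaloisField.finrank 2 hm0])
  have hcard := card_powerSums_eq_sum_sub hlam hlam0
  rw [← factorial_mul_ncard_powerSums, ← hN] at hcard
  simp only [traceSign_add A 1, hψ1] at hcard
  push_cast at hcard
  have hsum (i : Fin 8) : 2 * (n i : ℤ) =
      ∑ x ∈ univ.erase (0 : GaloisField 2 m), (1 + traceSign (f i x)) := by
    rw [hn, two_mul_ncard_trace_eq_zero]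
  have h1 := hsum 1
  have h2 := hsum 2
  have h3 := hsum 3
  have h4 := hsum 4
  have h5 := hsum 5
  have h6 := hsum 6
  have h7 := hsum 7
  simp only [hf4, hf5, hf6, hf7, hf1, hf2, hf3, traceSign_add] at h1 h2 h3 h4 h5 h6 h7
  constructor <;> intro hA
  · have hψ : traceSign A = 1 := by simp [traceSign, hA]
    rw [hψ] at hcard
    have hrhs : (2 : ℤ) * 2 ^ m - 2 - 2 * ((n 1 : ℤ) + n 2 + n 3 - n 4 - n 5 - n 6 + n 7) =
        2 * (2 ^ m - 1) - (2 * n 1 + 2 * n 2 + 2 * n 3 - 2 * n 4 - 2 * n 5 - 2 * n 6 + 2 * n 7) := by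
      ring
    rw [hcard, hrhs, h1, h2, h3, h4, h5, h6, h7, ← hq, mul_sum]
    simp only [← sum_add_distrib, ← sum_sub_distrib]
    norm_num only [mul_one, add_neg_cancel, mul_zero, sub_zero]
    refine sum_congr rfl fun x _ => ?_
    rcases traceSign_eq_or (lam * (x ^ 3 + x)) with e₁ | e₁ <;>
      rcases traceSign_eq_or (lam * ((x ^ 3)⁻¹ + x⁻¹)) with e₂ | e₂ <;>
      rcases traceSign_eq_or (lam * (x + x⁻¹)) with e₃ | e₃ <;>
      rw [e₁, e₂, e₃] <;> norm_num
  · have hψ : traceSign A = -1 := by simp [traceSign, hA]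
    rw [hψ] at hcard
    have hrhs : (-6 : ℤ) * 2 ^ m - 2 + 2 * ((n 1 : ℤ) + n 2 + n 3 + n 4 + n 5 + n 6 + n 7) =
        (2 * n 1 + 2 * n 2 + 2 * n 3 + 2 * n 4 + 2 * n 5 + 2 * n 6 + 2 * n 7) -
          6 * (2 ^ m - 1) - 8 := by
      ring
    rw [hcard, hrhs, h1, h2, h3, h4, h5, h6, h7, ← hq, mul_sum]
    simp only [← sum_add_distrib, ← sum_sub_distrib]
    norm_num only
    rw [sub_left_inj]
    refine sum_congr rfl fun x _ => ?_
    rcases traceSign_eq_or (lam * (x ^ 3 + x)) with e₁ | e₁ <;>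
      rcases traceSign_eq_or (lam * ((x ^ 3)⁻¹ + x⁻¹)) with e₂ | e₂ <;>
      rcases traceSign_eq_or (lam * (x + x⁻¹)) with e₃ | e₃ <;>
      rw [e₁, e₂, e₃] <;> norm_num
end
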